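/- Fix a real number u. As x → ∞, (1/x)·#{n : 1 < n ≤ x and ω(n − ω(n)) − log log x ≤ u·√(log log x)} tends to (1/√(2π)) ∫_{−∞}^{u} e^{−t²/2} dt (where the finitely many n with n − ω(n) ≤ 0 may be ignored without affecting the limit). -/

import Mathlib

open Filter

/-- The primes in the interval `(a, b]`. -/
def primesIoc (a b : ℕ) : Finset ℕ := (Finset.Ioc a b).filter Nat.Prime

lemma mem_primesIoc {a b p : ℕ} : p ∈ primesIoc a b ↔ (a < p ∧ p ≤ b) ∧ p.Prime := by
  simp [primesIoc]

lemma sum_primeFactors_log_le {n : ℕ} (hn : n ≠ 0) :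
    ∑ p ∈ n.primeFactors, Real.log p ≤ Real.log n := by
  rw [← Real.log_prod (fun p hp => by
    have := (Nat.prime_of_mem_primeFactors hp).pos
    positivity)]
  have h : ∏ p ∈ n.primeFactors, p ≤ n := Nat.le_of_dvd (Nat.pos_of_ne_zero hn)
    (Nat.prod_primeFactors_dvd n)
  have hpos : 0 < ∏ p ∈ n.primeFactors, p :=
    Finset.prod_pos fun p hp => (Nat.prime_of_mem_primeFactors hp).pos
  rw [← Nat.cast_prod]
  exact Real.log_le_log (Nat.cast_pos.2 hpos) (Nat.cast_le.2 h)

/-- The number of multiples of `d` in `[1, N]`. -/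
lemma card_filter_dvd_Ioc (N d : ℕ) :
    ((Finset.Ioc 0 N).filter (fun n => d ∣ n)).card = N / d :=
  Nat.Ioc_filter_dvd_card_eq_div N d

lemma sum_log_div_primes_le {N : ℕ} (hN : 1 ≤ N) :
    ∑ p ∈ primesIoc 0 N, Real.log p / p ≤ Real.log N + Real.log 4 := by
  have hN0 : (0 : ℝ) < N := by exact_mod_cast hN
  have h1 : ∑ p ∈ primesIoc 0 N, Real.log p * ((N / p : ℕ) : ℝ) ≤ N * Real.log N := by
    calc ∑ p ∈ primesIoc 0 N, Real.log p * ((N / p : ℕ) : ℝ)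
        = ∑ p ∈ primesIoc 0 N, ∑ n ∈ Finset.Ioc 0 N, if p ∣ n then Real.log p else 0 := by
          refine Finset.sum_congr rfl fun p _ => ?_
          rw [← Finset.sum_filter, Finset.sum_const, card_filter_dvd_Ioc, nsmul_eq_mul, mul_comm]
      _ = ∑ n ∈ Finset.Ioc 0 N, ∑ p ∈ primesIoc 0 N, if p ∣ n then Real.log p else 0 :=
          Finset.sum_comm
      _ ≤ ∑ n ∈ Finset.Ioc 0 N, Real.log N := by
          refine Finset.sum_le_sum fun n hn => ?_
          rw [Finset.mem_Ioc] at hn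
          rw [← Finset.sum_filter]
          have : (primesIoc 0 N).filter (fun p => p ∣ n) = n.primeFactors := by
            ext p
            simp only [Finset.mem_filter, mem_primesIoc, Nat.mem_primeFactors]
            constructor
            · rintro ⟨⟨_, h⟩, h'⟩; exact ⟨h, h', by omega⟩
            · rintro ⟨h, h', _⟩
              exact ⟨⟨⟨h.pos, (Nat.le_of_dvd hn.1 h').trans hn.2⟩, h⟩, h'⟩
          rw [this]
          refine (sum_primeFactors_log_le (by omega)).trans ?_
          exact Real.log_le_log (by exact_mod_cast hn.1) (by exact_mod_cast hn.2)
      _ = N * Real.log N := by simp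
  have h2 : ∑ p ∈ primesIoc 0 N, Real.log p ≤ Real.log 4 * N := by
    have := Chebyshev.theta_le_log4_mul_x (x := N) (by positivity)
    rw [Chebyshev.theta] at this
    simpa [primesIoc] using this
  have h3 : N * ∑ p ∈ primesIoc 0 N, Real.log p / p ≤ 
      ∑ p ∈ primesIoc 0 N, Real.log p * ((N / p : ℕ) : ℝ) + ∑ p ∈ primesIoc 0 N, Real.log p := by
    rw [← Finset.sum_add_distrib, Finset.mul_sum]
    refine Finset.sum_le_sum fun p hp => ?_
    have hp' := (mem_primesIoc.1 hp).2
    have hl : 0 ≤ Real.log p := Real.log_natCast_nonneg p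
    have : (N : ℝ) / p ≤ ((N / p : ℕ) : ℝ) + 1 := by
      rw [div_le_iff₀ (by exact_mod_cast hp'.pos)]
      have := Nat.lt_mul_div_succ N hp'.pos
      have h : (N : ℝ) < p * ((N / p : ℕ) + 1 : ℝ) := by exact_mod_cast this
      linarith
    calc (N : ℝ) * (Real.log p / p) = Real.log p * (N / p) := by ring
      _ ≤ Real.log p * (((N / p : ℕ) : ℝ) + 1) := by gcongr
      _ = _ := by ring
  have h4 : N * ∑ p ∈ primesIoc 0 N, Real.log p / p ≤ N * (Real.log N + Real.log 4) := by
    linarith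
  exact le_of_mul_le_mul_left h4 hN0

lemma primesIoc_succ (N : ℕ) : primesIoc 0 (N + 1) =
    if (N + 1).Prime then insert (N + 1) (primesIoc 0 N) else primesIoc 0 N := by
  ext p
  split_ifs with h
  · simp only [mem_primesIoc, Finset.mem_insert]
    constructor
    · rintro ⟨⟨h1, h2⟩, h3⟩
      by_cases hp : p = N + 1
      · exact Or.inl hp
      · exact Or.inr ⟨⟨h1, by omega⟩, h3⟩
    · rintro (rfl | ⟨⟨h1, h2⟩, h3⟩)
      · exact ⟨⟨by omega, le_rfl⟩, h⟩
      · exact ⟨⟨h1, by omega⟩, h3⟩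
  · simp only [mem_primesIoc]
    constructor
    · rintro ⟨⟨h1, h2⟩, h3⟩
      have : p ≠ N + 1 := by rintro rfl; exact h h3
      exact ⟨⟨h1, by omega⟩, h3⟩
    · rintro ⟨⟨h1, h2⟩, h3⟩
      exact ⟨⟨h1, by omega⟩, h3⟩

lemma notMem_primesIoc_succ (N : ℕ) : N + 1 ∉ primesIoc 0 N := by
  simp [mem_primesIoc]

lemma sum_inv_primes_add_le {N : ℕ} (hN : 2 ≤ N) :
    ∑ p ∈ primesIoc 0 N, (1 : ℝ) / p +
      (Real.log N + Real.log 4 - ∑ p ∈ primesIoc 0 N, Real.log p / p) / Real.log N ≤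
      Real.log (Real.log N) + (4 - Real.log (Real.log 2)) := by
  induction N, hN using Nat.le_induction with
  | base =>
    have : primesIoc 0 2 = {2} := by decide
    rw [this]
    have h2 : 0 < Real.log 2 := Real.log_pos (by norm_num)
    have h4 : Real.log 4 = 2 * Real.log 2 := by
      rw [show (4 : ℝ) = 2 ^ 2 by norm_num, Real.log_pow]; norm_num
    simp only [Finset.sum_singleton, Nat.cast_ofNat]
    rw [h4]
    field_simp
    nlinarith
  | succ N hN ih =>
    have hN' : (2 : ℝ) ≤ N := by exact_mod_cast hN
    have hl : 0 < Real.log N := Real.log_pos (by linarith)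
    have hll : Real.log N ≤ Real.log (N + 1) := Real.log_le_log (by linarith) (by linarith)
    have hl' : 0 < Real.log (N + 1) := by linarith
    have key : (Real.log (N + 1) - Real.log N) / Real.log (N + 1) ≤
        Real.log (Real.log (N + 1)) - Real.log (Real.log N) := by
      have := Real.log_le_sub_one_of_pos (div_pos hl hl')
      rw [Real.log_div hl.ne' hl'.ne'] at this
      rw [sub_div, div_self hl'.ne']
      linarith
    have hD := sum_log_div_primes_le (N := N) (by omega)
    have hD' : (Real.log N + Real.log 4 - ∑ p ∈ primesIoc 0 N, Real.log p / p) / Real.log (N + 1)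
        ≤ (Real.log N + Real.log 4 - ∑ p ∈ primesIoc 0 N, Real.log p / p) / Real.log N := by
      apply div_le_div_of_nonneg_left _ hl hll
      linarith
    have hadd : ∑ p ∈ primesIoc 0 (N + 1), (1 : ℝ) / p +
      (Real.log (N + 1) + Real.log 4 - ∑ p ∈ primesIoc 0 (N + 1), Real.log p / p) /
        Real.log (N + 1) = ∑ p ∈ primesIoc 0 N, (1 : ℝ) / p +
      (Real.log (N + 1) + Real.log 4 - ∑ p ∈ primesIoc 0 N, Real.log p / p) /
        Real.log (N + 1) := by
      rw [primesIoc_succ]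
      split_ifs with h
      · rw [Finset.sum_insert (notMem_primesIoc_succ N), Finset.sum_insert
          (notMem_primesIoc_succ N)]
        push_cast
        field_simp
        ring
      · rfl
    push_cast
    rw [hadd]
    have : (Real.log (N + 1) + Real.log 4 - ∑ p ∈ primesIoc 0 N, Real.log p / p) /
        Real.log (N + 1) = (Real.log N + Real.log 4 - ∑ p ∈ primesIoc 0 N, Real.log p / p) /
        Real.log (N + 1) + (Real.log (N + 1) - Real.log N) / Real.log (N + 1) := by ring
    rw [this]
    linarith

lemma sum_inv_sq_primes_le (N : ℕ) : ∑ p ∈ primesIoc 0 N, ((1 : ℝ) / p) ^ 2 ≤ 2 := by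
  calc ∑ p ∈ primesIoc 0 N, ((1 : ℝ) / p) ^ 2
      ≤ ∑ n ∈ Finset.Ioo 0 (N + 1), ((n : ℝ) ^ 2)⁻¹ := by
        simp only [one_div, inv_pow]
        apply Finset.sum_le_sum_of_subset_of_nonneg
        · intro p hp
          have := mem_primesIoc.1 hp
          simp only [Finset.mem_Ioo]; omega
        · intros; positivity
    _ ≤ 2 / ((0 : ℕ) + 1) := sum_Ioo_inv_sq_le 0 (N + 1)
    _ = 2 := by norm_num

lemma log_log_succ_le_sum_inv_primes {N : ℕ} (hN : 2 ≤ N) :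
    Real.log (Real.log (N + 1)) ≤ ∑ p ∈ primesIoc 0 N, (1 : ℝ) / p + 4 := by
  let f : ℕ →* ℝ :=
    { toFun := fun n => (n : ℝ)⁻¹, map_one' := by simp, map_mul' := fun a b => by
        push_cast; rw [mul_inv] }
  have hf : ∀ {p : ℕ}, p.Prime → ‖f p‖ < 1 := by
    intro p hp
    change ‖(p : ℝ)⁻¹‖ < 1
    rw [norm_inv, Real.norm_natCast]
    exact inv_lt_one_of_one_lt₀ (by exact_mod_cast hp.one_lt)
  obtain ⟨hs, hsum⟩ :=
    EulerProduct.summable_and_hasSum_smoothNumbers_prod_primesBelow_geometric hf (N + 1)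
  have hprimes : (N + 1).primesBelow = primesIoc 0 N := by
    ext p
    simp only [Nat.mem_primesBelow, mem_primesIoc]
    constructor
    · rintro ⟨h1, h2⟩; exact ⟨⟨h2.pos, by omega⟩, h2⟩
    · rintro ⟨⟨h1, h2⟩, h3⟩; exact ⟨by omega, h3⟩
  rw [hprimes] at hsum
  have hharm : Real.log (N + 1) ≤ ∏ p ∈ primesIoc 0 N, (1 - f p)⁻¹ := by
    have h1 : Real.log (N + 1) ≤ ∑ n ∈ Finset.Icc 1 N, (n : ℝ)⁻¹ := by
      have := log_add_one_le_harmonic N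
      rw [harmonic_eq_sum_Icc] at this
      push_cast at this
      exact this
    refine h1.trans ?_
    have hmem : ∀ n ∈ Finset.Icc 1 N, n ∈ (N + 1).smoothNumbers := fun n hn => by
      rw [Finset.mem_Icc] at hn
      exact Nat.mem_smoothNumbers_of_lt (by omega) (by omega)
    rw [← Finset.sum_attach]
    let e : {x // x ∈ Finset.Icc 1 N} ↪ (N + 1).smoothNumbers :=
      ⟨fun n => ⟨n.1, hmem n.1 n.2⟩, fun a b h =>
      Subtype.ext (congrArg (fun z : (N + 1).smoothNumbers => (z : ℕ)) h)⟩
    have := sum_le_hasSum ((Finset.Icc 1 N).attach.map e) (fun i _ => by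
      change (0 : ℝ) ≤ ((i : ℕ) : ℝ)⁻¹
      positivity) hsum
    rw [Finset.sum_map] at this
    exact this
  have hlog0 : 0 < Real.log (N + 1) := Real.log_pos (by
    have : (2 : ℝ) ≤ N := by exact_mod_cast hN
    linarith)
  have hlt : ∀ p ∈ primesIoc 0 N, (p : ℝ)⁻¹ ≤ 1 / 2 := fun p hp => by
    have h := (mem_primesIoc.1 hp).2.two_le
    rw [one_div]
    exact inv_anti₀ (by norm_num) (by exact_mod_cast h)
  refine (Real.log_le_log hlog0 hharm).trans ?_
  rw [Real.log_prod (fun p hp => by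
    have := hlt p hp
    change (1 - (p : ℝ)⁻¹)⁻¹ ≠ 0
    apply inv_ne_zero; linarith)]
  have hterm : ∀ p ∈ primesIoc 0 N,
      Real.log ((1 - f p)⁻¹) ≤ (1 : ℝ) / p + 2 * ((1 : ℝ) / p) ^ 2 := by
    intro p hp
    have h := hlt p hp
    have h0 : (0 : ℝ) ≤ (p : ℝ)⁻¹ := by positivity
    change Real.log ((1 - (p : ℝ)⁻¹)⁻¹) ≤ _
    rw [one_div]
    set t := (p : ℝ)⁻¹
    have h1 : 0 < (1 - t)⁻¹ := by apply inv_pos.2; linarith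
    refine (Real.log_le_sub_one_of_pos h1).trans ?_
    have h2 : (1 - t)⁻¹ - 1 = t + t ^ 2 * (1 - t)⁻¹ := by
      have : 1 - t ≠ 0 := by linarith
      field_simp
      ring
    have h3 : (1 - t)⁻¹ ≤ 2 := by
      rw [inv_le_comm₀ (by linarith) (by norm_num)]
      linarith
    rw [h2]
    nlinarith [sq_nonneg t]
  refine (Finset.sum_le_sum hterm).trans ?_
  rw [Finset.sum_add_distrib, ← Finset.mul_sum]
  have := sum_inv_sq_primes_le N
  linarith

/-- The sum of the reciprocals of the primes up to `y`. -/
noncomputable def primeRecip (y : ℝ) : ℝ := ∑ p ∈ primesIoc 0 ⌊y⌋₊, (1 : ℝ) / p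

/-- **Mertens' second theorem**, with an unspecified constant. -/
lemma exists_primeRecip_bound : ∃ C : ℝ, 0 ≤ C ∧ ∀ y : ℝ, 2 ≤ y →
    |primeRecip y - Real.log (Real.log y)| ≤ C := by
  have hll2 : Real.log (Real.log 2) ≤ 0 :=
    Real.log_nonpos (Real.log_nonneg (by norm_num))
      ((Real.log_le_sub_one_of_pos (by norm_num)).trans (by norm_num))
  refine ⟨4 - Real.log (Real.log 2), by linarith, fun y hy => ?_⟩
  have hN : 2 ≤ ⌊y⌋₊ := Nat.le_floor (by exact_mod_cast hy)
  have hN' : (2 : ℝ) ≤ ⌊y⌋₊ := by exact_mod_cast hN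
  have hly : 0 < Real.log y := Real.log_pos (by linarith)
  have hlN : 0 < Real.log ⌊y⌋₊ := Real.log_pos (by linarith)
  rw [abs_le]
  constructor
  · have h := log_log_succ_le_sum_inv_primes hN
    have h2 : Real.log (Real.log y) ≤ Real.log (Real.log (⌊y⌋₊ + 1)) :=
      Real.log_le_log hly (Real.log_le_log (by linarith) (Nat.lt_floor_add_one y).le)
    rw [primeRecip]
    linarith
  · have h := sum_inv_primes_add_le hN
    have h1 := sum_log_div_primes_le (N := ⌊y⌋₊) (by omega)
    have h3 : 0 ≤ (Real.log ⌊y⌋₊ + Real.log 4 - ∑ p ∈ primesIoc 0 ⌊y⌋₊, Real.log p / p) /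
        Real.log ⌊y⌋₊ := div_nonneg (by linarith) hlN.le
    have h2 : Real.log (Real.log ⌊y⌋₊) ≤ Real.log (Real.log y) :=
      Real.log_le_log hlN (Real.log_le_log (by linarith) (Nat.floor_le (by linarith)))
    rw [primeRecip]
    linarith

lemma sum_primesIoc_eq_sub {a b : ℝ} (hab : a ≤ b) :
    ∑ p ∈ primesIoc ⌊a⌋₊ ⌊b⌋₊, (1 : ℝ) / p = primeRecip b - primeRecip a := by
  have hab' := Nat.floor_mono hab
  rw [primeRecip, primeRecip, eq_sub_iff_add_eq, ← Finset.sum_union]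
  · congr 1
    ext p
    simp only [Finset.mem_union, mem_primesIoc]
    constructor
    · rintro (⟨⟨h1, h2⟩, h3⟩ | ⟨⟨h1, h2⟩, h3⟩)
      · exact ⟨⟨by omega, h2⟩, h3⟩
      · exact ⟨⟨h1, by omega⟩, h3⟩
    · rintro ⟨⟨h1, h2⟩, h3⟩
      by_cases h : p ≤ ⌊a⌋₊
      · exact Or.inr ⟨⟨h1, h⟩, h3⟩
      · exact Or.inl ⟨⟨by omega, h2⟩, h3⟩
  · rw [Finset.disjoint_left]
    intro p hp hp'
    have := mem_primesIoc.1 hp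
    have := mem_primesIoc.1 hp'
    omega

lemma norm_prod_sub_prod_le_sum {ι : Type*} (s : Finset ι) (a b : ι → ℂ)
    (ha : ∀ i ∈ s, ‖a i‖ ≤ 1) (hb : ∀ i ∈ s, ‖b i‖ ≤ 1) :
    ‖∏ i ∈ s, a i - ∏ i ∈ s, b i‖ ≤ ∑ i ∈ s, ‖a i - b i‖ := by
  classical
  induction s using Finset.induction_on with
  | empty => simp
  | insert i s hi ih =>
    rw [Finset.prod_insert hi, Finset.prod_insert hi, Finset.sum_insert hi]
    have h1 := ih (fun j hj => ha j (Finset.mem_insert_of_mem hj))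
      (fun j hj => hb j (Finset.mem_insert_of_mem hj))
    have h2 : ‖∏ j ∈ s, a j‖ ≤ 1 := by
      rw [norm_prod]
      exact Finset.prod_le_one (fun _ _ => norm_nonneg _)
        (fun j hj => ha j (Finset.mem_insert_of_mem hj))
    have h3 := hb i (Finset.mem_insert_self i s)
    calc ‖a i * ∏ j ∈ s, a j - b i * ∏ j ∈ s, b j‖
        = ‖(a i - b i) * ∏ j ∈ s, a j + b i * (∏ j ∈ s, a j - ∏ j ∈ s, b j)‖ := by
          congr 1; ring
      _ ≤ ‖a i - b i‖ * ‖∏ j ∈ s, a j‖ + ‖b i‖ * ‖∏ j ∈ s, a j - ∏ j ∈ s, b j‖ := by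
          refine (norm_add_le _ _).trans ?_
          rw [norm_mul, norm_mul]
      _ ≤ ‖a i - b i‖ * 1 + 1 * ‖∏ j ∈ s, a j - ∏ j ∈ s, b j‖ := by gcongr
      _ ≤ _ := by linarith

/-- A Bonferroni-type inequality: truncating the expansion of a product of complex numbers of
modulus at most one at subsets of size less than `R`. -/
lemma norm_prod_one_add_sub_truncation_le {ι : Type*} (s : Finset ι) (v : ι → ℂ)
    (hv : ∀ i ∈ s, ‖1 + v i‖ ≤ 1) (R : ℕ) :
    ‖∏ i ∈ s, (1 + v i) - ∑ t ∈ s.powerset, (if t.card < R then ∏ i ∈ t, v i else 0)‖ ≤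
      ∑ t ∈ s.powerset, (if t.card = R then ∏ i ∈ t, ‖v i‖ else 0) := by
  classical
  induction s using Finset.induction_on generalizing R with
  | empty => rcases R with _ | R <;> simp
  | insert i s hi ih =>
    have ih' := ih (fun j hj => hv j (Finset.mem_insert_of_mem hj))
    rcases R with _ | R
    · have h1 : ‖∏ i ∈ insert i s, (1 + v i)‖ ≤ 1 := by
        rw [norm_prod]
        exact Finset.prod_le_one (fun _ _ => norm_nonneg _) hv
      simpa [Finset.sum_ite, Finset.filter_eq', Finset.sum_filter] using h1
    · rw [Finset.sum_powerset_insert hi, Finset.sum_powerset_insert hi, Finset.prod_insert hi]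
      have hcard : ∀ t ∈ s.powerset, (insert i t).card = t.card + 1 := fun t ht =>
        Finset.card_insert_of_notMem fun h => hi (Finset.mem_powerset.1 ht h)
      have e1 : ∑ t ∈ s.powerset, (if (insert i t).card < R + 1 then
          ∏ j ∈ insert i t, v j else 0) =
          v i * ∑ t ∈ s.powerset, (if t.card < R then ∏ j ∈ t, v j else 0) := by
        rw [Finset.mul_sum]
        refine Finset.sum_congr rfl fun t ht => ?_
        rw [hcard t ht, Finset.prod_insert fun h => hi (Finset.mem_powerset.1 ht h)]
        simp
      have e2 : ∑ t ∈ s.powerset, (if (insert i t).card = R + 1 then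
          ∏ j ∈ insert i t, ‖v j‖ else 0) =
          ‖v i‖ * ∑ t ∈ s.powerset, (if t.card = R then ∏ j ∈ t, ‖v j‖ else 0) := by
        rw [Finset.mul_sum]
        refine Finset.sum_congr rfl fun t ht => ?_
        rw [hcard t ht, Finset.prod_insert fun h => hi (Finset.mem_powerset.1 ht h)]
        simp
      rw [e1, e2]
      have h1 := ih' (R + 1)
      have h2 := ih' R
      set P := ∏ j ∈ s, (1 + v j)
      set A := ∑ t ∈ s.powerset, (if t.card < R + 1 then ∏ j ∈ t, v j else 0)
      set B := ∑ t ∈ s.powerset, (if t.card < R then ∏ j ∈ t, v j else 0)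
      calc ‖(1 + v i) * P - (A + v i * B)‖ = ‖(P - A) + v i * (P - B)‖ := by congr 1; ring
        _ ≤ ‖P - A‖ + ‖v i‖ * ‖P - B‖ := by
          refine (norm_add_le _ _).trans ?_
          rw [norm_mul]
        _ ≤ _ := by gcongr

lemma sum_range_mul_of_coprime {R : Type*} [CommSemiring R] {a b : ℕ} (hab : a.Coprime b)
    (ha : a ≠ 0) (hb : b ≠ 0) (f g : ℕ → R) (hf : ∀ m, f (m % a) = f m)
    (hg : ∀ m, g (m % b) = g m) :
    ∑ m ∈ Finset.range (a * b), f m * g m =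
      (∑ m ∈ Finset.range a, f m) * ∑ m ∈ Finset.range b, g m := by
  rw [Finset.sum_mul_sum, ← Finset.sum_product']
  refine Finset.sum_nbij (fun m => (m % a, m % b)) ?_ ?_ ?_ ?_
  · intro m _
    simp only [Finset.mem_product, Finset.mem_range]
    exact ⟨Nat.mod_lt _ (Nat.pos_of_ne_zero ha), Nat.mod_lt _ (Nat.pos_of_ne_zero hb)⟩
  · intro m hm n hn h
    simp only [Prod.mk.injEq] at h
    have := (Nat.modEq_and_modEq_iff_modEq_mul hab).1 h
    simp only [Finset.coe_range, Set.mem_Iio] at hm hn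
    exact Nat.ModEq.eq_of_lt_of_lt this hm hn
  · rintro ⟨x, y⟩ hxy
    simp only [Finset.coe_product, Finset.coe_range, Set.mem_prod, Set.mem_Iio] at hxy
    refine ⟨Nat.chineseRemainder hab x y, ?_, ?_⟩
    · simpa using Nat.chineseRemainder_lt_mul hab x y ha hb
    · have h1 := (Nat.chineseRemainder hab x y).2.1
      have h2 := (Nat.chineseRemainder hab x y).2.2
      simp only [Prod.mk.injEq]
      exact ⟨Eq.trans h1 (Nat.mod_eq_of_lt hxy.1), Eq.trans h2 (Nat.mod_eq_of_lt hxy.2)⟩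
  · intro m _
    simp only [hf, hg]

lemma sum_range_prod_prod {R : Type*} [CommSemiring R] (S : Finset ℕ) (hS : ∀ q ∈ S, q.Prime)
    (w : ℕ → ℕ → R) (hw : ∀ q ∈ S, ∀ m, w q (m % q) = w q m) :
    ∑ m ∈ Finset.range (∏ q ∈ S, q), ∏ q ∈ S, w q m =
      ∏ q ∈ S, ∑ m ∈ Finset.range q, w q m := by
  induction S using Finset.induction_on with
  | empty => simp
  | insert q S hq ih =>
    have ih' := ih (fun j hj => hS j (Finset.mem_insert_of_mem hj))
      (fun j hj => hw j (Finset.mem_insert_of_mem hj))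
    have hqp := hS q (Finset.mem_insert_self q S)
    rw [Finset.prod_insert hq, Finset.prod_insert hq, ← ih']
    simp only [Finset.prod_insert hq]
    refine sum_range_mul_of_coprime ?_ hqp.ne_zero ?_ (w q) (fun m => ∏ j ∈ S, w j m)
      (hw q (Finset.mem_insert_self q S)) ?_
    · refine Nat.Coprime.prod_right fun j hj => ?_
      refine (Nat.coprime_primes hqp (hS j (Finset.mem_insert_of_mem hj))).2 ?_
      rintro rfl; exact hq hj
    · exact Finset.prod_ne_zero_iff.2 fun j hj => (hS j (Finset.mem_insert_of_mem hj)).ne_zero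
    · intro m
      refine Finset.prod_congr rfl fun j hj => ?_
      rw [← hw j (Finset.mem_insert_of_mem hj) (m % _), Nat.mod_mod_of_dvd _
        (Finset.dvd_prod_of_mem (fun x : ℕ => x) hj), hw j (Finset.mem_insert_of_mem hj)]

lemma norm_sum_range_periodic_sub_le {𝕜 : Type*} [RCLike 𝕜] {D : ℕ} (hD : D ≠ 0) (F : ℕ → 𝕜)
    (hF : ∀ m, F (m % D) = F m) (hF1 : ∀ m, ‖F m‖ ≤ 1) (M : ℕ) :
    ‖∑ m ∈ Finset.range M, F m - M * ((∑ m ∈ Finset.range D, F m) / D)‖ ≤ 2 * D := by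
  have hfull : ∀ k, ∑ m ∈ Finset.range (D * k), F m = k * ∑ m ∈ Finset.range D, F m := by
    intro k
    induction k with
    | zero => simp
    | succ k ih =>
      rw [Nat.mul_succ, Finset.sum_range_add, ih]
      have : ∑ x ∈ Finset.range D, F (D * k + x) = ∑ x ∈ Finset.range D, F x :=
        Finset.sum_congr rfl fun x _ => by
          rw [← hF (D * k + x), Nat.mul_add_mod, hF]
      rw [this]; push_cast; ring
  have hM : D * (M / D) + M % D = M := Nat.div_add_mod M D
  have hD' : (D : 𝕜) ≠ 0 := by exact_mod_cast hD
  have hbound : ∀ (s : Finset ℕ) (G : ℕ → 𝕜), (∀ m, ‖G m‖ ≤ 1) → ‖∑ m ∈ s, G m‖ ≤ s.card :=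
    fun s G hG => by
      refine (norm_sum_le _ _).trans ((Finset.sum_le_sum fun m _ => hG m).trans ?_)
      simp
  have hr : M % D < D := Nat.mod_lt _ (Nat.pos_of_ne_zero hD)
  have hA : ‖(∑ m ∈ Finset.range D, F m) / (D : 𝕜)‖ ≤ 1 := by
    rw [norm_div, RCLike.norm_natCast]
    apply div_le_one_of_le₀ _ (by positivity)
    simpa using hbound (Finset.range D) F hF1
  have key : ∑ m ∈ Finset.range M, F m - M * ((∑ m ∈ Finset.range D, F m) / D) =
      ∑ x ∈ Finset.range (M % D), F (D * (M / D) + x) -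
        ((M % D : ℕ) : 𝕜) * ((∑ m ∈ Finset.range D, F m) / D) := by
    conv_lhs => rw [← hM]
    rw [Finset.sum_range_add, hfull]
    push_cast
    field_simp
    ring
  rw [key]
  refine (norm_sub_le _ _).trans ?_
  have h1 := hbound (Finset.range (M % D)) (fun x => F (D * (M / D) + x)) fun m => hF1 _
  rw [Finset.card_range] at h1
  have h2 : ‖((M % D : ℕ) : 𝕜) * ((∑ m ∈ Finset.range D, F m) / D)‖ ≤ (M % D : ℕ) * 1 := by
    rw [norm_mul, RCLike.norm_natCast]
    gcongr
  have h3 : ((M % D : ℕ) : ℝ) ≤ D := by exact_mod_cast hr.le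
  linarith

lemma norm_sum_range_prod_sub_le {𝕜 : Type*} [RCLike 𝕜] (S : Finset ℕ)
    (hS : ∀ q ∈ S, q.Prime) (w : ℕ → ℕ → 𝕜) (hw : ∀ q ∈ S, ∀ m, w q (m % q) = w q m)
    (hw1 : ∀ q ∈ S, ∀ m, ‖w q m‖ ≤ 1) (M : ℕ) :
    ‖∑ m ∈ Finset.range M, ∏ q ∈ S, w q m -
      M * ∏ q ∈ S, ((∑ m ∈ Finset.range q, w q m) / q)‖ ≤ 2 * ∏ q ∈ S, (q : ℝ) := by
  have h := norm_sum_range_periodic_sub_le (D := ∏ q ∈ S, q)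
    (Finset.prod_ne_zero_iff.2 fun j hj => (hS j hj).ne_zero) (fun m => ∏ q ∈ S, w q m)
    (fun m => Finset.prod_congr rfl fun j hj => by
      rw [← hw j hj (m % _), Nat.mod_mod_of_dvd _ (Finset.dvd_prod_of_mem (fun x : ℕ => x) hj),
        hw j hj])
    (fun m => by
      rw [norm_prod]
      exact Finset.prod_le_one (fun _ _ => norm_nonneg _) fun j hj => hw1 j hj m) M
  rw [sum_range_prod_prod S hS w hw] at h
  rw [Finset.prod_div_distrib]
  push_cast at h
  exact h

lemma sum_powerset_card_eq_le_exp {ι : Type*} (s : Finset ι) (a : ι → ℝ) (ha : ∀ i ∈ s, 0 ≤ a i)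
    (R : ℕ) {l : ℝ} (hl : 0 < l) :
    ∑ t ∈ s.powerset, (if t.card = R then ∏ i ∈ t, a i else 0) ≤
      Real.exp (l * ∑ i ∈ s, a i) / l ^ R := by
  classical
  rw [le_div_iff₀ (by positivity), Finset.sum_mul]
  calc ∑ t ∈ s.powerset, (if t.card = R then ∏ i ∈ t, a i else 0) * l ^ R
      ≤ ∑ t ∈ s.powerset, ∏ i ∈ t, (l * a i) := by
        refine Finset.sum_le_sum fun t ht => ?_
        have hnn : ∀ i ∈ t, 0 ≤ a i := fun i hi => ha i (Finset.mem_powerset.1 ht hi)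
        split_ifs with h
        · rw [Finset.prod_mul_distrib, Finset.prod_const, h, mul_comm]
        · rw [zero_mul]
          exact Finset.prod_nonneg fun i hi => mul_nonneg hl.le (hnn i hi)
    _ = ∏ i ∈ s, (1 + l * a i) := (Finset.prod_one_add s).symm
    _ ≤ ∏ i ∈ s, Real.exp (l * a i) := by
        refine Finset.prod_le_prod (fun i hi => ?_) fun i hi => ?_
        · have := mul_nonneg hl.le (ha i hi); linarith
        · have := Real.add_one_le_exp (l * a i); linarith
    _ = _ := by rw [← Real.exp_sum, Finset.mul_sum]

lemma sum_powerset_prod_primes_le (Q : Finset ℕ) {T : ℕ} (hT : 1 ≤ T) (hQT : Q ⊆ Finset.Icc 1 T)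
    (R : ℕ) :
    ∑ S ∈ Q.powerset with S.card < R + 1, ∏ q ∈ S, (q : ℝ) ≤ (R + 1) * (T : ℝ) ^ (2 * R) := by
  classical
  have hT' : (1 : ℝ) ≤ T := by exact_mod_cast hT
  have hcard : Q.card ≤ T := by simpa using Finset.card_le_card hQT
  have hterm : ∀ S ∈ Q.powerset.filter (fun S => S.card < R + 1),
      ∏ q ∈ S, (q : ℝ) ≤ (T : ℝ) ^ R := by
    intro S hS
    rw [Finset.mem_filter, Finset.mem_powerset] at hS
    calc ∏ q ∈ S, (q : ℝ) ≤ ∏ q ∈ S, (T : ℝ) := by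
          refine Finset.prod_le_prod (fun _ _ => by positivity) fun q hq => ?_
          exact_mod_cast (Finset.mem_Icc.1 (hQT (hS.1 hq))).2
      _ = (T : ℝ) ^ S.card := by simp
      _ ≤ (T : ℝ) ^ R := pow_le_pow_right₀ hT' (by omega)
  have hnum : (Q.powerset.filter (fun S => S.card < R + 1)).card ≤ (R + 1) * T ^ R := by
    have hsub : Q.powerset.filter (fun S => S.card < R + 1) ⊆
        (Finset.range (R + 1)).biUnion fun j => Q.powersetCard j := by
      intro S hS
      rw [Finset.mem_filter, Finset.mem_powerset] at hS
      rw [Finset.mem_biUnion]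
      exact ⟨S.card, Finset.mem_range.2 hS.2, Finset.mem_powersetCard.2 ⟨hS.1, rfl⟩⟩
    refine (Finset.card_le_card hsub).trans (Finset.card_biUnion_le.trans ?_)
    calc ∑ j ∈ Finset.range (R + 1), (Q.powersetCard j).card
        ≤ ∑ j ∈ Finset.range (R + 1), T ^ R := by
          refine Finset.sum_le_sum fun j hj => ?_
          rw [Finset.card_powersetCard]
          calc Q.card.choose j ≤ Q.card ^ j := Nat.choose_le_pow _ _
            _ ≤ T ^ j := Nat.pow_le_pow_left hcard j
            _ ≤ T ^ R := Nat.pow_le_pow_right hT (by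
              have := Finset.mem_range.1 hj; omega)
      _ = (R + 1) * T ^ R := by simp
  calc ∑ S ∈ Q.powerset with S.card < R + 1, ∏ q ∈ S, (q : ℝ)
      ≤ ∑ S ∈ Q.powerset with S.card < R + 1, (T : ℝ) ^ R := Finset.sum_le_sum hterm
    _ = ((Q.powerset.filter (fun S => S.card < R + 1)).card : ℝ) * (T : ℝ) ^ R := by
        rw [Finset.sum_const, nsmul_eq_mul]
    _ ≤ (((R + 1) * T ^ R : ℕ) : ℝ) * (T : ℝ) ^ R := by
        gcongr
    _ = _ := by push_cast; ring

/-- The mean value of a product of local factors `1 + w q m`, with `w q` periodic modulo the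
prime `q`, is close to the product of the mean values of the factors. -/
lemma norm_sum_range_prod_one_add_sub_le (Q : Finset ℕ) (hQ : ∀ q ∈ Q, q.Prime) {T : ℕ}
    (hT : 1 ≤ T) (hQT : Q ⊆ Finset.Icc 1 T) (w : ℕ → ℕ → ℂ)
    (hw : ∀ q ∈ Q, ∀ m, w q (m % q) = w q m) (hw1 : ∀ q ∈ Q, ∀ m, ‖w q m‖ ≤ 1)
    (hw2 : ∀ q ∈ Q, ∀ m, ‖1 + w q m‖ ≤ 1) (M R : ℕ) {l s : ℝ} (hl : 0 < l)
    (hs : ∑ q ∈ Q, (∑ m ∈ Finset.range q, ‖w q m‖) / q ≤ s) :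
    ‖∑ m ∈ Finset.range M, ∏ q ∈ Q, (1 + w q m) -
      M * ∏ q ∈ Q, (1 + (∑ m ∈ Finset.range q, w q m) / q)‖ ≤
      2 * M * (Real.exp (l * s) / l ^ R) + 2 * ((R + 1) * (T : ℝ) ^ (2 * R)) := by
  classical
  set μ : ℕ → ℂ := fun q => (∑ m ∈ Finset.range q, w q m) / q with hμ
  set ν : ℕ → ℝ := fun q => (∑ m ∈ Finset.range q, ‖w q m‖) / q with hν
  have hμν : ∀ q ∈ Q, ‖μ q‖ ≤ ν q := fun q hq => by
    rw [hμ, hν]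
    simp only [norm_div, RCLike.norm_natCast]
    gcongr
    exact norm_sum_le _ _
  have hν0 : ∀ q ∈ Q, 0 ≤ ν q := fun q hq => by rw [hν]; positivity
  have hμ1 : ∀ q ∈ Q, ‖1 + μ q‖ ≤ 1 := fun q hq => by
    have hq0 : (q : ℂ) ≠ 0 := by exact_mod_cast (hQ q hq).ne_zero
    have : 1 + μ q = (∑ m ∈ Finset.range q, (1 + w q m)) / q := by
      rw [Finset.sum_add_distrib, hμ]
      simp only [Finset.sum_const, Finset.card_range, nsmul_eq_mul, mul_one]
      field_simp
    rw [this, norm_div, RCLike.norm_natCast]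
    apply div_le_one_of_le₀ _ (by positivity)
    refine (norm_sum_le _ _).trans ((Finset.sum_le_sum fun m _ => hw2 q hq m).trans ?_)
    simp
  -- the three error terms
  set E : ℝ := Real.exp (l * s) / l ^ R with hE
  have heR : ∑ t ∈ Q.powerset, (if t.card = R then ∏ i ∈ t, ν i else 0) ≤ E := by
    refine (sum_powerset_card_eq_le_exp Q ν hν0 R hl).trans ?_
    rw [hE]
    gcongr
  have hsubQ : ∀ t ∈ Q.powerset, ∀ q ∈ t, q ∈ Q := fun t ht q hq => Finset.mem_powerset.1 ht hq
  have h1 : ‖∑ m ∈ Finset.range M, (∏ q ∈ Q, (1 + w q m) -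
      ∑ t ∈ Q.powerset, (if t.card < R then ∏ q ∈ t, w q m else 0))‖ ≤
      M * E + ∑ t ∈ Q.powerset, (if t.card = R then 2 * ∏ q ∈ t, (q : ℝ) else 0) := by
    calc _ ≤ ∑ m ∈ Finset.range M,
          ∑ t ∈ Q.powerset, (if t.card = R then ∏ q ∈ t, ‖w q m‖ else 0) :=
          (norm_sum_le _ _).trans (Finset.sum_le_sum fun m _ =>
            norm_prod_one_add_sub_truncation_le Q (fun q => w q m) (fun q hq => hw2 q hq m) R)
      _ = ∑ t ∈ Q.powerset, ∑ m ∈ Finset.range M,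
          (if t.card = R then ∏ q ∈ t, ‖w q m‖ else 0) := Finset.sum_comm
      _ ≤ ∑ t ∈ Q.powerset, (M * (if t.card = R then ∏ q ∈ t, ν q else 0) +
          (if t.card = R then 2 * ∏ q ∈ t, (q : ℝ) else 0)) := by
          refine Finset.sum_le_sum fun t ht => ?_
          split_ifs with h
          · have := norm_sum_range_prod_sub_le (𝕜 := ℝ) t (fun q hq => hQ q (hsubQ t ht q hq))
              (fun q m => ‖w q m‖) (fun q hq m => by rw [hw q (hsubQ t ht q hq)])
              (fun q hq m => by simpa using hw1 q (hsubQ t ht q hq) m) M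
            have := (abs_le.1 (Real.norm_eq_abs _ ▸ this)).2
            linarith
          · simp
      _ ≤ _ := by
          rw [Finset.sum_add_distrib, ← Finset.mul_sum]
          gcongr
  have h2 : ‖∑ m ∈ Finset.range M, ∑ t ∈ Q.powerset, (if t.card < R then ∏ q ∈ t, w q m else 0) -
      M * ∑ t ∈ Q.powerset, (if t.card < R then ∏ q ∈ t, μ q else 0)‖ ≤
      ∑ t ∈ Q.powerset, (if t.card < R then 2 * ∏ q ∈ t, (q : ℝ) else 0) := by
    rw [Finset.sum_comm, Finset.mul_sum, ← Finset.sum_sub_distrib]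
    refine (norm_sum_le _ _).trans (Finset.sum_le_sum fun t ht => ?_)
    split_ifs with h
    · exact norm_sum_range_prod_sub_le (𝕜 := ℂ) t (fun q hq => hQ q (hsubQ t ht q hq)) w
        (fun q hq m => hw q (hsubQ t ht q hq) m) (fun q hq m => hw1 q (hsubQ t ht q hq) m) M
    · simp
  have h3 : ‖∏ q ∈ Q, (1 + μ q) -
      ∑ t ∈ Q.powerset, (if t.card < R then ∏ q ∈ t, μ q else 0)‖ ≤ E := by
    refine (norm_prod_one_add_sub_truncation_le Q μ hμ1 R).trans (le_trans ?_ heR)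
    refine Finset.sum_le_sum fun t ht => ?_
    split_ifs with h
    · exact Finset.prod_le_prod (fun _ _ => norm_nonneg _) fun q hq => hμν q (hsubQ t ht q hq)
    · exact le_rfl
  have h4 : ∑ t ∈ Q.powerset, (if t.card = R then 2 * ∏ q ∈ t, (q : ℝ) else 0) +
      ∑ t ∈ Q.powerset, (if t.card < R then 2 * ∏ q ∈ t, (q : ℝ) else 0) ≤
      2 * ((R + 1) * (T : ℝ) ^ (2 * R)) := by
    have := sum_powerset_prod_primes_le Q hT hQT R
    rw [Finset.sum_filter] at this
    rw [← Finset.sum_add_distrib]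
    refine le_trans ?_ (mul_le_mul_of_nonneg_left this (by norm_num : (0 : ℝ) ≤ 2))
    rw [Finset.mul_sum]
    refine Finset.sum_le_sum fun t ht => ?_
    rcases lt_trichotomy t.card R with h | h | h
    · rw [if_neg (by omega), if_pos h, if_pos (by omega)]; simp
    · rw [if_pos h, if_neg (by omega), if_pos (by omega)]; simp
    · rw [if_neg (by omega), if_neg (by omega), if_neg (by omega)]; simp
  rw [Finset.sum_sub_distrib] at h1
  set P := ∑ m ∈ Finset.range M, ∏ q ∈ Q, (1 + w q m)
  set A := ∑ m ∈ Finset.range M, ∑ t ∈ Q.powerset, (if t.card < R then ∏ q ∈ t, w q m else 0)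
  set B := ∑ t ∈ Q.powerset, (if t.card < R then ∏ q ∈ t, μ q else 0)
  set G := ∏ q ∈ Q, (1 + μ q)
  have h5 : ‖(M : ℂ) * (G - B)‖ ≤ M * E := by
    rw [norm_mul, RCLike.norm_natCast]
    gcongr
  calc ‖P - M * G‖ = ‖(P - A) + (A - M * B) - M * (G - B)‖ := by congr 1; ring
    _ ≤ ‖P - A‖ + ‖A - M * B‖ + ‖(M : ℂ) * (G - B)‖ :=
        (norm_sub_le _ _).trans (by gcongr; exact norm_add_le _ _)
    _ ≤ _ := by linarith

/-- The multiplicative function `m ↦ ∏ (1 + h)` over the primes `q ∈ Q` dividing `m`. -/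
noncomputable def twist (Q : Finset ℕ) (h : ℂ) (m : ℕ) : ℂ :=
  ∏ q ∈ Q, (1 + if q ∣ m then h else 0)

/-- The mean value of `twist Q h`. -/
noncomputable def twistMean (Q : Finset ℕ) (h : ℂ) : ℂ := ∏ q ∈ Q, (1 + h / q)

lemma norm_one_add_ite_le {h : ℂ} (hh : ‖1 + h‖ = 1) (P : Prop) [Decidable P] :
    ‖1 + if P then h else 0‖ ≤ 1 := by
  split_ifs
  · exact hh.le
  · simp

lemma norm_twist_le {h : ℂ} (hh : ‖1 + h‖ = 1) (Q : Finset ℕ) (m : ℕ) : ‖twist Q h m‖ ≤ 1 := by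
  rw [twist, norm_prod]
  exact Finset.prod_le_one (fun _ _ => norm_nonneg _) fun q _ => norm_one_add_ite_le hh _

lemma norm_one_add_div_le {h : ℂ} (hh : ‖1 + h‖ = 1) {q : ℕ} (hq : 1 ≤ q) :
    ‖1 + h / q‖ ≤ 1 := by
  have hq' : (1 : ℝ) ≤ q := by exact_mod_cast hq
  have hq0 : (q : ℂ) ≠ 0 := by
    have : q ≠ 0 := by omega
    exact_mod_cast this
  have e : 1 + h / q = ((q - 1 : ℝ) + (1 + h)) / q := by
    field_simp
    push_cast
    ring
  rw [e, norm_div, RCLike.norm_natCast]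
  apply div_le_one_of_le₀ _ (by positivity)
  refine (norm_add_le _ _).trans ?_
  rw [hh, Complex.norm_real, Real.norm_of_nonneg (by linarith)]
  linarith

lemma norm_twistMean_le {h : ℂ} (hh : ‖1 + h‖ = 1) {Q : Finset ℕ} (hQ : ∀ q ∈ Q, q.Prime) :
    ‖twistMean Q h‖ ≤ 1 := by
  rw [twistMean, norm_prod]
  exact Finset.prod_le_one (fun _ _ => norm_nonneg _) fun q hq =>
    norm_one_add_div_le hh (hQ q hq).one_lt.le

lemma sum_range_ite_mul_modEq {R : Type*} [AddCommMonoid R] {q p : ℕ} (hq : q.Prime)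
    (hp : p.Coprime q) (k : ℕ) (x : R) :
    ∑ m ∈ Finset.range q, (if p * m ≡ k [MOD q] then x else 0) = x := by
  obtain ⟨m, -, hm⟩ := Nat.exists_mul_mod_eq_one_of_coprime hp hq.one_lt
  have hm1 : p * m ≡ 1 [MOD q] := by
    rw [Nat.ModEq, hm, Nat.mod_eq_of_lt hq.one_lt]
  have hm0 : p * ((m * k) % q) ≡ k [MOD q] := by
    calc p * ((m * k) % q) ≡ p * (m * k) [MOD q] := (Nat.mod_modEq _ _).mul_left _
      _ = (p * m) * k := by ring
      _ ≡ 1 * k [MOD q] := hm1.mul_right _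
      _ = k := one_mul k
  rw [Finset.sum_eq_single ((m * k) % q)]
  · rw [if_pos hm0]
  · intro b hb hne
    rw [if_neg]
    intro h
    apply hne
    have h1 : b ≡ (m * k) % q [MOD q] :=
      Nat.ModEq.cancel_left_of_coprime (by rwa [Nat.coprime_comm] at hp) (h.trans hm0.symm)
    exact Nat.ModEq.eq_of_lt_of_lt h1 (Finset.mem_range.1 hb) (Nat.mod_lt _ hq.pos)
  · intro h
    exact absurd (Finset.mem_range.2 (Nat.mod_lt _ hq.pos)) h

lemma mul_mod_modEq_iff (p m k q : ℕ) : p * (m % q) ≡ k [MOD q] ↔ p * m ≡ k [MOD q] :=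
  have h : p * (m % q) ≡ p * m [MOD q] := (Nat.mod_modEq _ _).mul_left _
  ⟨fun h' => h.symm.trans h', fun h' => h.trans h'⟩

lemma dvd_mul_sub_iff_modEq {p m k q : ℕ} (h : k ≤ p * m) :
    q ∣ p * m - k ↔ p * m ≡ k [MOD q] := by
  rw [← Nat.modEq_iff_dvd' h]
  exact Nat.ModEq.comm

lemma norm_sum_Ioc_sub_le {F : ℕ → ℂ} {G : ℂ} (hF : ‖F 0‖ ≤ 1) (hG : ‖G‖ ≤ 1) {M : ℕ} {B : ℝ}
    (h : ‖∑ m ∈ Finset.range (M + 1), F m - (M + 1 : ℕ) * G‖ ≤ B) :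
    ‖∑ m ∈ Finset.Ioc 0 M, F m - M * G‖ ≤ B + 2 := by
  have e : ∑ m ∈ Finset.range (M + 1), F m = F 0 + ∑ m ∈ Finset.Ioc 0 M, F m := by
    rw [Finset.range_eq_Ico, Finset.sum_eq_sum_Ico_succ_bot (by omega)]
    congr 1
  have : ∑ m ∈ Finset.Ioc 0 M, F m - M * G =
      (∑ m ∈ Finset.range (M + 1), F m - (M + 1 : ℕ) * G) - F 0 + G := by
    rw [e]; push_cast; ring
  rw [this]
  refine (norm_add_le _ _).trans ?_
  have := norm_sub_le (∑ m ∈ Finset.range (M + 1), F m - (M + 1 : ℕ) * G) (F 0)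
  linarith

section Correlation

variable {Q : Finset ℕ} {h : ℂ} {T k : ℕ}

lemma norm_sum_twist_sub_le (hQ : ∀ q ∈ Q, q.Prime) (hT : 1 ≤ T) (hQT : Q ⊆ Finset.Icc 1 T)
    (hh : ‖1 + h‖ = 1) (hh1 : ‖h‖ ≤ 1) {p : ℕ} (hkp : k ≤ p) (hp : ∀ q ∈ Q, p.Coprime q)
    (M R : ℕ) {l s : ℝ} (hl : 0 < l) (hs : 2 * ‖h‖ * ∑ q ∈ Q, (1 : ℝ) / q ≤ s) :
    ‖∑ m ∈ Finset.Ioc 0 M, twist Q h (p * m - k) - M * twistMean Q h‖ ≤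
      2 * (M + 1 : ℕ) * (Real.exp (l * s) / l ^ R) + 2 * ((R + 1) * (T : ℝ) ^ (2 * R)) + 2 := by
  have e : ∑ m ∈ Finset.Ioc 0 M, twist Q h (p * m - k) =
      ∑ m ∈ Finset.Ioc 0 M, ∏ q ∈ Q, (1 + if p * m ≡ k [MOD q] then h else 0) := by
    refine Finset.sum_congr rfl fun m hm => ?_
    have hkm : k ≤ p * m := hkp.trans (Nat.le_mul_of_pos_right p (Finset.mem_Ioc.1 hm).1)
    simp only [twist, dvd_mul_sub_iff_modEq hkm]
  have e2 : twistMean Q h = ∏ q ∈ Q, (1 +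
      (∑ m ∈ Finset.range q, if p * m ≡ k [MOD q] then h else 0) / q) := by
    refine Finset.prod_congr rfl fun q hq => ?_
    rw [sum_range_ite_mul_modEq (hQ q hq) (hp q hq)]
  rw [e]
  refine norm_sum_Ioc_sub_le ?_ (norm_twistMean_le hh hQ) ?_
  · rw [norm_prod]
    exact Finset.prod_le_one (fun _ _ => norm_nonneg _) fun q _ => norm_one_add_ite_le hh _
  · rw [e2]
    refine norm_sum_range_prod_one_add_sub_le Q hQ hT hQT
      (fun q m => if p * m ≡ k [MOD q] then h else 0) ?_ ?_ ?_ (M + 1) R hl ?_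
    · intro q _ m
      simp only [mul_mod_modEq_iff]
    · intro q _ m
      split_ifs <;> simp [hh1]
    · intro q _ m
      exact norm_one_add_ite_le hh _
    · refine le_trans ?_ hs
      rw [Finset.mul_sum]
      refine Finset.sum_le_sum fun q hq => ?_
      have : ∑ m ∈ Finset.range q, ‖if p * m ≡ k [MOD q] then h else 0‖ = ‖h‖ := by
        rw [← sum_range_ite_mul_modEq (hQ q hq) (hp q hq) k ‖h‖]
        refine Finset.sum_congr rfl fun m _ => ?_
        split_ifs <;> simp
      rw [this, mul_one_div]
      gcongr
      linarith [norm_nonneg h]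

open ComplexConjugate

/-- The mean value of the correlation of `twist Q h` along two arithmetic progressions. -/
noncomputable def pairMean (Q : Finset ℕ) (h : ℂ) (p p' : ℕ) : ℂ :=
  ∏ q ∈ Q, (1 + if p ≡ p' [MOD q] then 0 else (h + conj h) / q)

lemma one_add_mul_conj {h : ℂ} (hh : ‖1 + h‖ = 1) : (1 + h) * (1 + conj h) = 1 := by
  have : (1 + conj h) = conj (1 + h) := by simp
  rw [this, Complex.mul_conj, Complex.normSq_eq_norm_sq, hh]
  simp

lemma norm_one_add_conj {h : ℂ} (hh : ‖1 + h‖ = 1) : ‖1 + conj h‖ = 1 := by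
  have : (1 + conj h) = conj (1 + h) := by simp
  rw [this, RCLike.norm_conj, hh]

lemma add_conj_eq {h : ℂ} (hh : ‖1 + h‖ = 1) : h + conj h = -((‖h‖ ^ 2 : ℝ) : ℂ) := by
  have h1 := one_add_mul_conj hh
  have h2 : h * conj h = ((‖h‖ ^ 2 : ℝ) : ℂ) := by
    rw [Complex.mul_conj, Complex.normSq_eq_norm_sq]
  linear_combination h1 - h2

lemma norm_sum_twist_mul_conj_sub_le (hQ : ∀ q ∈ Q, q.Prime) (hT : 1 ≤ T)
    (hQT : Q ⊆ Finset.Icc 1 T) (hh : ‖1 + h‖ = 1) (hh1 : ‖h‖ ≤ 1) (hk : 0 < k)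
    (hkQ : ∀ q ∈ Q, k < q) {p p' : ℕ} (hkp : k ≤ p) (hkp' : k ≤ p')
    (hp : ∀ q ∈ Q, p.Coprime q) (hp' : ∀ q ∈ Q, p'.Coprime q)
    (M R : ℕ) {l s : ℝ} (hl : 0 < l) (hs : 2 * ‖h‖ * ∑ q ∈ Q, (1 : ℝ) / q ≤ s) :
    ‖∑ m ∈ Finset.Ioc 0 M, twist Q h (p * m - k) * conj (twist Q h (p' * m - k)) -
      M * pairMean Q h p p'‖ ≤
      2 * (M + 1 : ℕ) * (Real.exp (l * s) / l ^ R) + 2 * ((R + 1) * (T : ℝ) ^ (2 * R)) + 2 := by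
  classical
  let w : ℕ → ℕ → ℂ := fun q m => (1 + if p * m ≡ k [MOD q] then h else 0) *
    (1 + if p' * m ≡ k [MOD q] then conj h else 0) - 1
  have hw1 : ∀ q m, ‖1 + w q m‖ ≤ 1 := by
    intro q m
    have e : 1 + w q m = (1 + if p * m ≡ k [MOD q] then h else 0) *
      (1 + if p' * m ≡ k [MOD q] then conj h else 0) := by simp [w]
    rw [e, norm_mul]
    exact mul_le_one₀ (norm_one_add_ite_le hh _) (norm_nonneg _)
      (norm_one_add_ite_le (norm_one_add_conj hh) _)
  have hwsum : ∀ q ∈ Q, ∑ m ∈ Finset.range q, w q m =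
      if p ≡ p' [MOD q] then 0 else h + conj h := by
    intro q hq
    split_ifs with hpp
    · refine Finset.sum_eq_zero fun m _ => ?_
      have : p' * m ≡ k [MOD q] ↔ p * m ≡ k [MOD q] :=
        ⟨fun h' => (hpp.mul_right m).trans h', fun h' => (hpp.mul_right m).symm.trans h'⟩
      simp only [w, this]
      split_ifs
      · rw [one_add_mul_conj hh, sub_self]
      · simp
    · have hsum : h + conj h = ∑ m ∈ Finset.range q,
          ((if p * m ≡ k [MOD q] then h else 0) + (if p' * m ≡ k [MOD q] then conj h else 0)) := by
        rw [Finset.sum_add_distrib, sum_range_ite_mul_modEq (hQ q hq) (hp q hq),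
          sum_range_ite_mul_modEq (hQ q hq) (hp' q hq)]
      rw [hsum]
      refine Finset.sum_congr rfl fun m _ => ?_
      simp only [w]
      by_cases h1 : p * m ≡ k [MOD q] <;> by_cases h2 : p' * m ≡ k [MOD q]
      · exfalso
        have h3 : p * m ≡ p' * m [MOD q] := h1.trans h2.symm
        by_cases hm : q ∣ m
        · have h4 : p * m ≡ 0 [MOD q] := (Nat.modEq_zero_iff_dvd).2 (hm.mul_left p)
          have h5 : q ∣ k := (Nat.modEq_zero_iff_dvd).1 (h1.symm.trans h4)
          exact absurd (Nat.le_of_dvd hk h5) (by have := hkQ q hq; omega)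
        · exact hpp (Nat.ModEq.cancel_right_of_coprime
            (((hQ q hq).coprime_iff_not_dvd).2 hm) h3)
      · simp [h1, h2]
      · simp [h1, h2]
      · simp [h1, h2]
  have hwle : ∀ q m, ‖w q m‖ ≤ (if p * m ≡ k [MOD q] then ‖h‖ else 0) +
      (if p' * m ≡ k [MOD q] then ‖h‖ else 0) ∧ ‖w q m‖ ≤ 1 := by
    intro q m
    simp only [w]
    by_cases h1 : p * m ≡ k [MOD q] <;> by_cases h2 : p' * m ≡ k [MOD q]
    · simp only [h1, h2, if_true, one_add_mul_conj hh, sub_self, norm_zero]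
      exact ⟨by positivity, zero_le_one⟩
    · simp [h1, h2, hh1]
    · simp [h1, h2, hh1]
    · simp [h1, h2]
  have e : ∑ m ∈ Finset.Ioc 0 M, twist Q h (p * m - k) * conj (twist Q h (p' * m - k)) =
      ∑ m ∈ Finset.Ioc 0 M, ∏ q ∈ Q, (1 + w q m) := by
    refine Finset.sum_congr rfl fun m hm => ?_
    have hkm : k ≤ p * m := hkp.trans (Nat.le_mul_of_pos_right p (Finset.mem_Ioc.1 hm).1)
    have hkm' : k ≤ p' * m := hkp'.trans (Nat.le_mul_of_pos_right p' (Finset.mem_Ioc.1 hm).1)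
    simp only [twist, dvd_mul_sub_iff_modEq hkm, dvd_mul_sub_iff_modEq hkm', map_prod,
      ← Finset.prod_mul_distrib]
    refine Finset.prod_congr rfl fun q _ => ?_
    simp only [w, map_add, map_one, apply_ite conj, map_zero]
    ring
  have e2 : pairMean Q h p p' = ∏ q ∈ Q, (1 + (∑ m ∈ Finset.range q, w q m) / q) := by
    refine Finset.prod_congr rfl fun q hq => ?_
    rw [hwsum q hq]
    split_ifs <;> simp
  have hG : ‖pairMean Q h p p'‖ ≤ 1 := by
    rw [e2, norm_prod]
    refine Finset.prod_le_one (fun _ _ => norm_nonneg _) fun q hq => ?_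
    have hq0 : (q : ℂ) ≠ 0 := by exact_mod_cast (hQ q hq).ne_zero
    have : 1 + (∑ m ∈ Finset.range q, w q m) / q =
        (∑ m ∈ Finset.range q, (1 + w q m)) / q := by
      rw [Finset.sum_add_distrib]
      simp only [Finset.sum_const, Finset.card_range, nsmul_eq_mul, mul_one]
      field_simp
    rw [this, norm_div, RCLike.norm_natCast]
    apply div_le_one_of_le₀ _ (by positivity)
    refine (norm_sum_le _ _).trans ((Finset.sum_le_sum fun m _ => hw1 q m).trans ?_)
    simp
  rw [e]
  refine norm_sum_Ioc_sub_le ?_ hG ?_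
  · rw [norm_prod]
    exact Finset.prod_le_one (fun _ _ => norm_nonneg _) fun q _ => hw1 q 0
  · rw [e2]
    refine norm_sum_range_prod_one_add_sub_le Q hQ hT hQT w ?_ (fun q _ m => (hwle q m).2)
      (fun q _ m => hw1 q m) (M + 1) R hl ?_
    · intro q _ m
      simp only [w, mul_mod_modEq_iff]
    · refine le_trans ?_ hs
      rw [Finset.mul_sum]
      refine Finset.sum_le_sum fun q hq => ?_
      have : ∑ m ∈ Finset.range q, ‖w q m‖ ≤ 2 * ‖h‖ := by
        refine (Finset.sum_le_sum fun m _ => (hwle q m).1).trans ?_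
        rw [Finset.sum_add_distrib, sum_range_ite_mul_modEq (hQ q hq) (hp q hq),
          sum_range_ite_mul_modEq (hQ q hq) (hp' q hq)]
        linarith
      rw [mul_one_div]
      gcongr

lemma norm_pairMean_sub_le (hQ : ∀ q ∈ Q, q.Prime) (hh : ‖1 + h‖ = 1) (hh1 : ‖h‖ ≤ 1)
    {z : ℝ} (hz : 0 < z) (hzQ : ∀ q ∈ Q, z ≤ q) (p p' : ℕ) :
    ‖pairMean Q h p p' - twistMean Q h * conj (twistMean Q h)‖ ≤
      (∑ q ∈ Q, (1 : ℝ) / q + (Q.filter fun q => p ≡ p' [MOD q]).card) / z := by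
  classical
  have e : twistMean Q h * conj (twistMean Q h) =
      ∏ q ∈ Q, ((1 + h / q) * (1 + conj h / q)) := by
    simp only [twistMean, map_prod, ← Finset.prod_mul_distrib]
    simp
  rw [e, pairMean]
  refine (norm_prod_sub_prod_le_sum Q _ _ ?_ ?_).trans ?_
  · intro q hq
    have hq1 := (hQ q hq).two_le
    have hq2 : (2 : ℝ) ≤ q := by exact_mod_cast hq1
    split_ifs
    · simp
    · rw [add_conj_eq hh]
      have hh2 : ‖h‖ ^ 2 ≤ 1 := pow_le_one₀ (norm_nonneg _) hh1
      have : (1 : ℂ) + -((‖h‖ ^ 2 : ℝ) : ℂ) / q = ((1 - ‖h‖ ^ 2 / q : ℝ) : ℂ) := by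
        push_cast; ring
      rw [this, Complex.norm_real, Real.norm_eq_abs, abs_le]
      have h1 : ‖h‖ ^ 2 / q ≤ 1 := by
        rw [div_le_one (by linarith)]; linarith
      have h0 : 0 ≤ ‖h‖ ^ 2 / q := by positivity
      constructor <;> linarith
  · intro q hq
    rw [norm_mul]
    exact mul_le_one₀ (norm_one_add_div_le hh (hQ q hq).one_lt.le) (norm_nonneg _)
      (norm_one_add_div_le (norm_one_add_conj hh) (hQ q hq).one_lt.le)
  · rw [add_div, Finset.card_filter, Nat.cast_sum, Finset.sum_div, Finset.sum_div,
      ← Finset.sum_add_distrib]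
    refine Finset.sum_le_sum fun q hq => ?_
    have hq1 := (hQ q hq).two_le
    have hq2 : (2 : ℝ) ≤ q := by exact_mod_cast hq1
    have hq0 : (q : ℂ) ≠ 0 := by exact_mod_cast (hQ q hq).ne_zero
    have hzq := hzQ q hq
    have hprod : (1 + h / q) * (1 + conj h / q) =
        1 + (h + conj h) / q + ((‖h‖ ^ 2 : ℝ) : ℂ) / (q ^ 2 : ℝ) := by
      have h2 : h * conj h = ((‖h‖ ^ 2 : ℝ) : ℂ) := by
        rw [Complex.mul_conj, Complex.normSq_eq_norm_sq]
      rw [← h2]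
      push_cast
      field_simp
      ring
    rw [hprod]
    have hh2 : ‖h‖ ^ 2 ≤ 1 := pow_le_one₀ (norm_nonneg _) hh1
    have hh0 : 0 ≤ ‖h‖ ^ 2 := by positivity
    split_ifs
    · rw [add_conj_eq hh]
      have : (1 + 0 : ℂ) - (1 + -((‖h‖ ^ 2 : ℝ) : ℂ) / q + ((‖h‖ ^ 2 : ℝ) : ℂ) / (q ^ 2 : ℝ)) =
          ((‖h‖ ^ 2 * (1 / q - 1 / q ^ 2) : ℝ) : ℂ) := by
        push_cast; ring
      rw [this, Complex.norm_real, Real.norm_eq_abs]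
      have h1 : 1 / (q : ℝ) ^ 2 ≤ 1 / q := by
        apply one_div_le_one_div_of_le (by linarith)
        nlinarith
      have h2 : 0 ≤ 1 / (q : ℝ) ^ 2 := by positivity
      rw [abs_of_nonneg (mul_nonneg hh0 (by linarith))]
      have h3 : 1 / (q : ℝ) ≤ 1 / z := one_div_le_one_div_of_le hz hzq
      have h4 : (0 : ℝ) ≤ 1 / q / z := by positivity
      calc ‖h‖ ^ 2 * (1 / (q : ℝ) - 1 / q ^ 2) ≤ 1 * (1 / q) := by
            apply mul_le_mul hh2 (by linarith) (by linarith) (by norm_num)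
        _ ≤ 1 / z := by linarith
        _ ≤ _ := by push_cast; linarith
    · have : (1 + (h + conj h) / q : ℂ) -
          (1 + (h + conj h) / q + ((‖h‖ ^ 2 : ℝ) : ℂ) / (q ^ 2 : ℝ)) =
          ((-(‖h‖ ^ 2 / q ^ 2) : ℝ) : ℂ) := by
        push_cast; ring
      rw [this, Complex.norm_real, norm_neg, Real.norm_of_nonneg (by positivity)]
      have h3 : (1 : ℝ) / q ≤ 1 / z := one_div_le_one_div_of_le hz hzq
      calc ‖h‖ ^ 2 / (q : ℝ) ^ 2 ≤ 1 / (q : ℝ) ^ 2 := by gcongr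
        _ = 1 / (q : ℝ) * (1 / (q : ℝ)) := by ring
        _ ≤ 1 / (q : ℝ) * (1 / z) := by gcongr
        _ = _ := by push_cast; ring

lemma norm_sum_centered_correlation_le (hQ : ∀ q ∈ Q, q.Prime) (hT : 1 ≤ T)
    (hQT : Q ⊆ Finset.Icc 1 T) (hh : ‖1 + h‖ = 1) (hh1 : ‖h‖ ≤ 1) (hk : 0 < k)
    (hkQ : ∀ q ∈ Q, k < q) {p p' : ℕ} (hkp : k ≤ p) (hkp' : k ≤ p')
    (hp : ∀ q ∈ Q, p.Coprime q) (hp' : ∀ q ∈ Q, p'.Coprime q)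
    (M R : ℕ) {l s z : ℝ} (hl : 0 < l) (hs : 2 * ‖h‖ * ∑ q ∈ Q, (1 : ℝ) / q ≤ s)
    (hz : 0 < z) (hzQ : ∀ q ∈ Q, z ≤ q) :
    ‖∑ m ∈ Finset.Ioc 0 M, (twist Q h (p * m - k) - twistMean Q h) *
      conj (twist Q h (p' * m - k) - twistMean Q h)‖ ≤
      3 * (2 * (M + 1 : ℕ) * (Real.exp (l * s) / l ^ R) +
        2 * ((R + 1) * (T : ℝ) ^ (2 * R)) + 2) +
      M * ((∑ q ∈ Q, (1 : ℝ) / q + (Q.filter fun q => p ≡ p' [MOD q]).card) / z) := by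
  have h1 := norm_sum_twist_sub_le hQ hT hQT hh hh1 hkp hp M R hl hs
  have h2 := norm_sum_twist_sub_le hQ hT hQT hh hh1 hkp' hp' M R hl hs
  have h3 := norm_sum_twist_mul_conj_sub_le hQ hT hQT hh hh1 hk hkQ hkp hkp' hp hp' M R hl hs
  have h4 := norm_pairMean_sub_le hQ hh hh1 hz hzQ p p'
  have hc := norm_twistMean_le hh hQ
  set B := 2 * (M + 1 : ℕ) * (Real.exp (l * s) / l ^ R) + 2 * ((R + 1) * (T : ℝ) ^ (2 * R)) + 2
  set c := twistMean Q h
  set G := pairMean Q h p p'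
  have e : ∑ m ∈ Finset.Ioc 0 M, (twist Q h (p * m - k) - c) * conj (twist Q h (p' * m - k) - c) =
      (∑ m ∈ Finset.Ioc 0 M, twist Q h (p * m - k) * conj (twist Q h (p' * m - k)) - M * G) +
      M * (G - c * conj c) - conj c * (∑ m ∈ Finset.Ioc 0 M, twist Q h (p * m - k) - M * c) -
      c * conj (∑ m ∈ Finset.Ioc 0 M, twist Q h (p' * m - k) - M * c) := by
    have : ∀ m, (twist Q h (p * m - k) - c) * conj (twist Q h (p' * m - k) - c) =
        twist Q h (p * m - k) * conj (twist Q h (p' * m - k)) - conj c * twist Q h (p * m - k) -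
        c * conj (twist Q h (p' * m - k)) + c * conj c := fun m => by
      rw [map_sub]; ring
    rw [Finset.sum_congr rfl fun m _ => this m]
    simp only [Finset.sum_add_distrib, Finset.sum_sub_distrib, ← Finset.mul_sum,
      Finset.sum_const, Nat.card_Ioc, nsmul_eq_mul, map_sub, map_sum, map_mul, Complex.conj_natCast,
      Nat.sub_zero]
    ring
  rw [e]
  have n1 : ‖(M : ℂ) * (G - c * conj c)‖ ≤
      M * ((∑ q ∈ Q, (1 : ℝ) / q + (Q.filter fun q => p ≡ p' [MOD q]).card) / z) := by
    rw [norm_mul, RCLike.norm_natCast]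
    gcongr
  have n2 : ‖conj c * (∑ m ∈ Finset.Ioc 0 M, twist Q h (p * m - k) - M * c)‖ ≤ 1 * B := by
    rw [norm_mul, RCLike.norm_conj]
    gcongr
  have n3 : ‖c * conj (∑ m ∈ Finset.Ioc 0 M, twist Q h (p' * m - k) - M * c)‖ ≤ 1 * B := by
    rw [norm_mul, RCLike.norm_conj]
    gcongr
  refine (norm_sub_le _ _).trans ?_
  refine (add_le_add (norm_sub_le _ _) le_rfl).trans ?_
  refine (add_le_add (add_le_add (norm_add_le _ _) le_rfl) le_rfl).trans ?_
  linarith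

end Correlation

/-- **Turán's inequality** for the number of prime divisors from a finite set of primes. -/
lemma sum_sq_card_filter_dvd_sub_le {P : Finset ℕ} (hP : ∀ p ∈ P, p.Prime) (N : ℕ) :
    ∑ n ∈ Finset.Ioc 0 N, (((P.filter (· ∣ n)).card : ℝ) - ∑ p ∈ P, (1 : ℝ) / p) ^ 2 ≤
      N * (∑ p ∈ P, (1 : ℝ) / p) + 2 * (∑ p ∈ P, (1 : ℝ) / p) * P.card := by
  classical
  set W := ∑ p ∈ P, (1 : ℝ) / p with hW
  have hW0 : 0 ≤ W := Finset.sum_nonneg fun p _ => by positivity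
  have hc : ∀ n, ((P.filter (· ∣ n)).card : ℝ) = ∑ p ∈ P, if p ∣ n then (1 : ℝ) else 0 := by
    intro n
    rw [Finset.card_filter]
    push_cast
    rfl
  have hcount : ∀ d : ℕ, ∑ n ∈ Finset.Ioc 0 N, (if d ∣ n then (1 : ℝ) else 0) = (N / d : ℕ) := by
    intro d
    rw [← Finset.sum_filter, Finset.sum_const, nsmul_eq_mul, mul_one, card_filter_dvd_Ioc]
  have h1 : (N : ℝ) * W - P.card ≤ ∑ n ∈ Finset.Ioc 0 N, ((P.filter (· ∣ n)).card : ℝ) := by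
    simp only [hc]
    rw [Finset.sum_comm]
    simp only [hcount]
    rw [hW, Finset.mul_sum, Finset.card_eq_sum_ones, Nat.cast_sum, ← Finset.sum_sub_distrib]
    refine Finset.sum_le_sum fun p hp => ?_
    have hp0 : (0 : ℝ) < p := by exact_mod_cast (hP p hp).pos
    have := Nat.lt_floor_add_one ((N : ℝ) / p)
    rw [Nat.floor_div_natCast, Nat.floor_natCast] at this
    rw [mul_one_div]
    push_cast
    linarith
  have h2 : ∑ n ∈ Finset.Ioc 0 N, ((P.filter (· ∣ n)).card : ℝ) ^ 2 ≤ N * W ^ 2 + N * W := by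
    have e : ∀ n, ((P.filter (· ∣ n)).card : ℝ) ^ 2 =
        ∑ p ∈ P, ∑ p' ∈ P, if p ∣ n ∧ p' ∣ n then (1 : ℝ) else 0 := by
      intro n
      rw [hc, sq, Finset.sum_mul_sum]
      refine Finset.sum_congr rfl fun p _ => Finset.sum_congr rfl fun p' _ => ?_
      by_cases h : p ∣ n <;> by_cases h' : p' ∣ n <;> simp [h, h']
    simp only [e]
    rw [Finset.sum_comm, sq, hW, Finset.sum_mul_sum, Finset.mul_sum, Finset.mul_sum,
      ← Finset.sum_add_distrib]
    refine Finset.sum_le_sum fun p hp => ?_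
    rw [Finset.sum_comm]
    have hle : ∀ p' ∈ P, ∑ n ∈ Finset.Ioc 0 N, (if p ∣ n ∧ p' ∣ n then (1 : ℝ) else 0) ≤
        N * (1 / p * (1 / p')) + if p = p' then N * (1 / (p : ℝ)) else 0 := by
      intro p' hp'
      split_ifs with hpp
      · subst hpp
        simp only [and_self]
        rw [hcount]
        have := @Nat.cast_div_le ℝ _ _ _ N p
        have h0 : (0 : ℝ) ≤ N * (1 / p * (1 / p)) := by positivity
        rw [mul_one_div (N : ℝ) (p : ℝ)]
        linarith
      · have hcop : p.Coprime p' := (Nat.coprime_primes (hP p hp) (hP p' hp')).2 hpp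
        have : ∀ n, (p ∣ n ∧ p' ∣ n) ↔ p * p' ∣ n := fun n =>
          ⟨fun h => hcop.mul_dvd_of_dvd_of_dvd h.1 h.2,
            fun h => ⟨(Dvd.intro _ rfl).trans h, (Dvd.intro_left _ rfl).trans h⟩⟩
        simp only [this]
        rw [hcount]
        have := @Nat.cast_div_le ℝ _ _ _ N (p * p')
        push_cast at this
        refine this.trans (le_of_eq ?_)
        rw [add_zero]
        ring
    refine (Finset.sum_le_sum hle).trans ?_
    rw [Finset.sum_add_distrib, Finset.sum_ite_eq, if_pos hp, ← Finset.mul_sum]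
  have e : ∑ n ∈ Finset.Ioc 0 N, (((P.filter (· ∣ n)).card : ℝ) - W) ^ 2 =
      ∑ n ∈ Finset.Ioc 0 N, ((P.filter (· ∣ n)).card : ℝ) ^ 2 -
      2 * W * ∑ n ∈ Finset.Ioc 0 N, ((P.filter (· ∣ n)).card : ℝ) + N * W ^ 2 := by
    have : ∀ n, (((P.filter (· ∣ n)).card : ℝ) - W) ^ 2 =
      ((P.filter (· ∣ n)).card : ℝ) ^ 2 - 2 * W * ((P.filter (· ∣ n)).card : ℝ) + W ^ 2 :=
      fun n => by ring
    simp only [this, Finset.sum_add_distrib, Finset.sum_sub_distrib, ← Finset.mul_sum,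
      Finset.sum_const, Nat.card_Ioc, nsmul_eq_mul, Nat.sub_zero]
  rw [e]
  nlinarith [mul_le_mul_of_nonneg_left h1 hW0]

lemma norm_sum_natCast_mul_le {F : ℕ → ℂ} {M : ℕ} {B : ℝ}
    (hF : ∀ l ≤ M, ‖∑ m ∈ Finset.Ioc 0 l, F m‖ ≤ B) :
    ‖∑ m ∈ Finset.Ioc 0 M, (m : ℂ) * F m‖ ≤ 2 * M * B := by
  have e : ∑ m ∈ Finset.Ioc 0 M, (m : ℂ) * F m =
      ∑ l ∈ Finset.range M, (∑ m ∈ Finset.Ioc 0 M, F m - ∑ m ∈ Finset.Ioc 0 l, F m) := by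
    clear hF
    induction M with
    | zero => simp
    | succ M ih =>
      rw [Finset.sum_Ioc_succ_top (Nat.zero_le _), ih, Finset.sum_range_succ,
        Finset.sum_Ioc_succ_top (Nat.zero_le _)]
      simp only [Finset.sum_sub_distrib, Finset.sum_const, Finset.card_range, nsmul_eq_mul]
      push_cast
      ring
  rw [e]
  refine (norm_sum_le _ _).trans ?_
  have : ∀ l ∈ Finset.range M,
      ‖∑ m ∈ Finset.Ioc 0 M, F m - ∑ m ∈ Finset.Ioc 0 l, F m‖ ≤ 2 * B := by
    intro l hl
    have h1 := hF M le_rfl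
    have h2 := hF l (Finset.mem_range.1 hl).le
    exact (norm_sub_le _ _).trans (by linarith)
  refine (Finset.sum_le_sum this).trans (le_of_eq ?_)
  rw [Finset.sum_const, Finset.card_range, nsmul_eq_mul]
  ring

lemma sum_Ioc_mul_card_filter_dvd {P : Finset ℕ} (hP : ∀ p ∈ P, 0 < p) (N : ℕ) (a : ℕ → ℂ) :
    ∑ n ∈ Finset.Ioc 0 N, a n * ((P.filter (· ∣ n)).card : ℂ) =
      ∑ p ∈ P, ∑ m ∈ Finset.Ioc 0 (N / p), a (p * m) := by
  have e : ∀ n, a n * ((P.filter (· ∣ n)).card : ℂ) = ∑ p ∈ P, if p ∣ n then a n else 0 := by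
    intro n
    rw [Finset.card_filter, Nat.cast_sum, Finset.mul_sum]
    refine Finset.sum_congr rfl fun p _ => ?_
    split_ifs <;> simp
  simp only [e]
  rw [Finset.sum_comm]
  refine Finset.sum_congr rfl fun p hp => ?_
  have hp0 := hP p hp
  rw [← Finset.sum_filter]
  symm
  refine Finset.sum_bij (fun m _ => p * m) ?_ ?_ ?_ ?_
  · intro m hm
    rw [Finset.mem_Ioc, Nat.le_div_iff_mul_le hp0] at hm
    rw [Finset.mem_filter, Finset.mem_Ioc]
    exact ⟨⟨Nat.mul_pos hp0 hm.1, by rw [mul_comm]; exact hm.2⟩, Dvd.intro _ rfl⟩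
  · intro m _ m' _ h
    exact Nat.eq_of_mul_eq_mul_left hp0 h
  · intro n hn
    rw [Finset.mem_filter, Finset.mem_Ioc] at hn
    obtain ⟨m, rfl⟩ := hn.2
    refine ⟨m, ?_, rfl⟩
    rw [Finset.mem_Ioc, Nat.le_div_iff_mul_le hp0]
    exact ⟨Nat.pos_of_mul_pos_left hn.1.1, by rw [mul_comm]; exact hn.1.2⟩
  · intro m _
    rfl

lemma card_primeFactors_prime_mul {p m : ℕ} (hp : p.Prime) (h : ¬ p ∣ m) :
    (p * m).primeFactors.card = m.primeFactors.card + 1 := by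
  have hcop : p.Coprime m := (hp.coprime_iff_not_dvd).2 h
  rw [hcop.primeFactors_mul, hp.primeFactors, Finset.card_union_of_disjoint, Finset.card_singleton,
    add_comm]
  rw [Finset.disjoint_singleton_left]
  exact fun h' => h (Nat.dvd_of_mem_primeFactors h')

section Katai

open ComplexConjugate

variable {ψ : ℕ → ℂ} {c : ℂ} {P : Finset ℕ} {N : ℕ}

lemma sum_mul_sq_norm_sum_le (hψ : ∀ n, ‖ψ n‖ ≤ 1) (hc : ‖c‖ ≤ 1) (hP : ∀ p ∈ P, 0 < p) (k : ℕ)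
    {ε : ℝ} (hε : 0 ≤ ε)
    (hcorr : ∀ p ∈ P, ∀ p' ∈ P, p ≠ p' → ∀ M ≤ N / p, M ≤ N / p' →
      ‖∑ m ∈ Finset.Ioc 0 M, (ψ (p * m - k) - c) * conj (ψ (p' * m - k) - c)‖ ≤ ε * (N / p')) :
    ∑ m ∈ Finset.Ioc 0 N, (m : ℝ) *
        ‖∑ p ∈ P, (if p * m ≤ N then ψ (p * m - k) - c else 0)‖ ^ 2 ≤
      N ^ 2 * (4 * ∑ p ∈ P, (1 / (p : ℝ)) ^ 2 + 2 * ε * (∑ p ∈ P, (1 : ℝ) / p) ^ 2) := by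
  classical
  have hb : ∀ n, ‖ψ n - c‖ ≤ 2 := fun n => (norm_sub_le _ _).trans (by linarith [hψ n])
  have e : ((∑ m ∈ Finset.Ioc 0 N, (m : ℝ) *
        ‖∑ p ∈ P, (if p * m ≤ N then ψ (p * m - k) - c else 0)‖ ^ 2 : ℝ) : ℂ) =
      ∑ p ∈ P, ∑ p' ∈ P, ∑ m ∈ Finset.Ioc 0 (min (N / p) (N / p')),
        (m : ℂ) * ((ψ (p * m - k) - c) * conj (ψ (p' * m - k) - c)) := by
    push_cast
    have e1 : ∀ m ∈ Finset.Ioc 0 N, (m : ℂ) *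
        (‖∑ p ∈ P, (if p * m ≤ N then ψ (p * m - k) - c else 0)‖ : ℂ) ^ 2 =
        ∑ p ∈ P, ∑ p' ∈ P, if p * m ≤ N ∧ p' * m ≤ N then
          (m : ℂ) * ((ψ (p * m - k) - c) * conj (ψ (p' * m - k) - c)) else 0 := by
      intro m _
      rw [← Complex.ofReal_pow, ← Complex.normSq_eq_norm_sq, ← Complex.mul_conj, map_sum,
        Finset.sum_mul_sum, Finset.mul_sum]
      refine Finset.sum_congr rfl fun p _ => ?_
      rw [Finset.mul_sum]
      refine Finset.sum_congr rfl fun p' _ => ?_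
      by_cases h : p * m ≤ N <;> by_cases h' : p' * m ≤ N <;> simp [h, h']
    rw [Finset.sum_congr rfl e1, Finset.sum_comm]
    refine Finset.sum_congr rfl fun p hp => ?_
    rw [Finset.sum_comm]
    refine Finset.sum_congr rfl fun p' hp' => ?_
    rw [← Finset.sum_filter]
    refine Finset.sum_congr ?_ fun _ _ => rfl
    ext m
    have hp0 := hP p hp
    have hp0' := hP p' hp'
    rw [Finset.mem_filter, Finset.mem_Ioc, Finset.mem_Ioc, le_min_iff,
      Nat.le_div_iff_mul_le hp0, Nat.le_div_iff_mul_le hp0', mul_comm m, mul_comm m]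
    constructor
    · rintro ⟨h1, h2⟩
      exact ⟨h1.1, h2⟩
    · rintro ⟨h1, h2⟩
      exact ⟨⟨h1, (Nat.le_mul_of_pos_left m hp0).trans h2.1⟩, h2⟩
  have hterm : ∀ p ∈ P, ∀ p' ∈ P, ‖∑ m ∈ Finset.Ioc 0 (min (N / p) (N / p')),
        (m : ℂ) * ((ψ (p * m - k) - c) * conj (ψ (p' * m - k) - c))‖ ≤
      (if p = p' then 4 * (N : ℝ) ^ 2 * (1 / (p : ℝ)) ^ 2 else 0) +
        2 * ε * N ^ 2 * (1 / p * (1 / p')) := by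
    intro p hp p' hp'
    split_ifs with hpp
    · subst hpp
      rw [min_self]
      have hM := @Nat.cast_div_le ℝ _ _ _ N p
      have h2 : ‖∑ m ∈ Finset.Ioc 0 (N / p),
          (m : ℂ) * ((ψ (p * m - k) - c) * conj (ψ (p * m - k) - c))‖ ≤
          ∑ m ∈ Finset.Ioc 0 (N / p), ((N : ℝ) / p) * 4 := by
        refine (norm_sum_le _ _).trans (Finset.sum_le_sum fun m hm => ?_)
        rw [norm_mul, norm_mul, RCLike.norm_natCast, RCLike.norm_conj]
        have h3 : (m : ℝ) ≤ N / p :=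
          le_trans (by exact_mod_cast (Finset.mem_Ioc.1 hm).2) hM
        have h4 := hb (p * m - k)
        have h5 : ‖ψ (p * m - k) - c‖ * ‖ψ (p * m - k) - c‖ ≤ 4 := by
          nlinarith [norm_nonneg (ψ (p * m - k) - c)]
        exact mul_le_mul h3 h5 (by positivity) (by positivity)
      rw [Finset.sum_const, Nat.card_Ioc, nsmul_eq_mul, Nat.sub_zero] at h2
      have h6 : ((N / p : ℕ) : ℝ) * ((N : ℝ) / p * 4) ≤ (N : ℝ) / p * ((N : ℝ) / p * 4) := by
        gcongr
      have h7 : (0 : ℝ) ≤ 2 * ε * N ^ 2 * (1 / p * (1 / p)) := by positivity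
      have h8 : (N : ℝ) / p * ((N : ℝ) / p * 4) = 4 * (N : ℝ) ^ 2 * (1 / (p : ℝ)) ^ 2 := by ring
      linarith
    · have h1 := norm_sum_natCast_mul_le (M := min (N / p) (N / p')) (B := ε * (N / p'))
        (F := fun m => (ψ (p * m - k) - c) * conj (ψ (p' * m - k) - c))
        (fun l hl => hcorr p hp p' hp' hpp l (hl.trans (min_le_left _ _))
          (hl.trans (min_le_right _ _)))
      refine h1.trans ?_
      have hM : ((min (N / p) (N / p') : ℕ) : ℝ) ≤ N / p :=
        le_trans (by exact_mod_cast min_le_left _ _) (@Nat.cast_div_le ℝ _ _ _ N p)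
      calc 2 * ((min (N / p) (N / p') : ℕ) : ℝ) * (ε * (N / p')) ≤
            2 * ((N : ℝ) / p) * (ε * (N / p')) := by gcongr
        _ = _ := by ring
  have hnorm : ∑ m ∈ Finset.Ioc 0 N, (m : ℝ) *
        ‖∑ p ∈ P, (if p * m ≤ N then ψ (p * m - k) - c else 0)‖ ^ 2 =
      ‖∑ p ∈ P, ∑ p' ∈ P, ∑ m ∈ Finset.Ioc 0 (min (N / p) (N / p')),
        (m : ℂ) * ((ψ (p * m - k) - c) * conj (ψ (p' * m - k) - c))‖ := by
    rw [← e, Complex.norm_real, Real.norm_of_nonneg]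
    exact Finset.sum_nonneg fun m _ => by positivity
  rw [hnorm]
  refine (norm_sum_le _ _).trans ((Finset.sum_le_sum fun p hp => (norm_sum_le _ _).trans
    (Finset.sum_le_sum fun p' hp' => hterm p hp p' hp')).trans (le_of_eq ?_))
  simp only [Finset.sum_add_distrib]
  rw [mul_add, Finset.mul_sum, Finset.mul_sum, sq (∑ p ∈ P, (1 : ℝ) / p), Finset.sum_mul_sum]
  congr 1
  · refine Finset.sum_congr rfl fun p hp => ?_
    rw [Finset.sum_ite_eq, if_pos hp]
    ring
  · simp only [Finset.mul_sum]
    refine Finset.sum_congr rfl fun p hp => Finset.sum_congr rfl fun p' hp' => ?_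
    ring

/-- A Turán–Kátai inequality for sums over `n - ω(n)`. -/
lemma norm_sum_sub_card_primeFactors_le (hψ : ∀ n, ‖ψ n‖ ≤ 1) (hc : ‖c‖ ≤ 1)
    (hP : ∀ p ∈ P, p.Prime) {K : ℕ} (hK : ∀ m ∈ Finset.Ioc 0 N, m.primeFactors.card + 1 ≤ K)
    {ε H : ℝ} (hε : 0 ≤ ε) (hH : ∑ m ∈ Finset.Ioc 0 N, (1 : ℝ) / m ≤ H)
    (hcorr : ∀ k ∈ Finset.Icc 1 K, ∀ p ∈ P, ∀ p' ∈ P, p ≠ p' → ∀ M ≤ N / p, M ≤ N / p' →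
      ‖∑ m ∈ Finset.Ioc 0 M, (ψ (p * m - k) - c) * conj (ψ (p' * m - k) - c)‖ ≤ ε * (N / p')) :
    (∑ p ∈ P, (1 : ℝ) / p) * ‖∑ n ∈ Finset.Ioc 0 N, (ψ (n - n.primeFactors.card) - c)‖ ≤
      2 * √N * √(N * (∑ p ∈ P, (1 : ℝ) / p) + 2 * (∑ p ∈ P, (1 : ℝ) / p) * P.card) +
      2 * N * ∑ p ∈ P, (1 / (p : ℝ)) ^ 2 +
      N * √(H * (K * (4 * ∑ p ∈ P, (1 / (p : ℝ)) ^ 2 +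
        2 * ε * (∑ p ∈ P, (1 : ℝ) / p) ^ 2))) := by
  classical
  set W := ∑ p ∈ P, (1 : ℝ) / p with hW
  set V := ∑ p ∈ P, (1 / (p : ℝ)) ^ 2 with hV
  have hW0 : 0 ≤ W := Finset.sum_nonneg fun p _ => by positivity
  have hV0 : 0 ≤ V := Finset.sum_nonneg fun p _ => by positivity
  have hb : ∀ n, ‖ψ n - c‖ ≤ 2 := fun n => (norm_sub_le _ _).trans (by linarith [hψ n])
  set a : ℕ → ℂ := fun n => ψ (n - n.primeFactors.card) - c with ha
  have hP0 : ∀ p ∈ P, 0 < p := fun p hp => (hP p hp).pos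
  set S : ℕ → ℕ → ℂ := fun k m => ∑ p ∈ P, (if p * m ≤ N then ψ (p * m - k) - c else 0) with hS
  have hsplit : (W : ℂ) * ∑ n ∈ Finset.Ioc 0 N, a n =
      ∑ n ∈ Finset.Ioc 0 N, a n * ((W - (P.filter (· ∣ n)).card : ℝ) : ℂ) +
      (∑ p ∈ P, ∑ m ∈ Finset.Ioc 0 (N / p), a (p * m) -
        ∑ m ∈ Finset.Ioc 0 N, S (m.primeFactors.card + 1) m) +
      ∑ m ∈ Finset.Ioc 0 N, S (m.primeFactors.card + 1) m := by
    rw [← sum_Ioc_mul_card_filter_dvd hP0]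
    push_cast
    simp only [mul_sub, Finset.sum_sub_distrib, ← Finset.sum_mul]
    ring
  have hcs : ∀ f g : ℕ → ℝ, ∑ m ∈ Finset.Ioc 0 N, f m * g m ≤
      √(∑ m ∈ Finset.Ioc 0 N, f m ^ 2) * √(∑ m ∈ Finset.Ioc 0 N, g m ^ 2) := fun f g =>
    Real.sum_mul_le_sqrt_mul_sqrt _ f g
  have h1 : ‖∑ n ∈ Finset.Ioc 0 N, a n * ((W - (P.filter (· ∣ n)).card : ℝ) : ℂ)‖ ≤
      2 * √N * √(N * W + 2 * W * P.card) := by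
    calc ‖∑ n ∈ Finset.Ioc 0 N, a n * ((W - (P.filter (· ∣ n)).card : ℝ) : ℂ)‖
        ≤ ∑ n ∈ Finset.Ioc 0 N, 2 * |W - (P.filter (· ∣ n)).card| := by
          refine (norm_sum_le _ _).trans (Finset.sum_le_sum fun n _ => ?_)
          rw [norm_mul, Complex.norm_real, Real.norm_eq_abs]
          gcongr
          exact hb _
      _ ≤ √(∑ m ∈ Finset.Ioc 0 N, (2 : ℝ) ^ 2) *
          √(∑ m ∈ Finset.Ioc 0 N, |W - (P.filter (· ∣ m)).card| ^ 2) := hcs _ _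
      _ ≤ √(2 ^ 2 * N) * √(N * W + 2 * W * P.card) := by
          gcongr
          · rw [Finset.sum_const, Nat.card_Ioc, nsmul_eq_mul, Nat.sub_zero, mul_comm]
          · refine le_trans (le_of_eq ?_) (sum_sq_card_filter_dvd_sub_le hP N)
            refine Finset.sum_congr rfl fun n _ => ?_
            rw [sq_abs]
            ring
      _ = _ := by
          rw [Real.sqrt_mul (by norm_num), Real.sqrt_sq (by norm_num)]
  have h2 : ‖∑ p ∈ P, ∑ m ∈ Finset.Ioc 0 (N / p), a (p * m) -
        ∑ m ∈ Finset.Ioc 0 N, S (m.primeFactors.card + 1) m‖ ≤ 2 * N * V := by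
    have e : ∑ m ∈ Finset.Ioc 0 N, S (m.primeFactors.card + 1) m =
        ∑ p ∈ P, ∑ m ∈ Finset.Ioc 0 (N / p),
          (ψ (p * m - (m.primeFactors.card + 1)) - c) := by
      simp only [hS]
      rw [Finset.sum_comm]
      refine Finset.sum_congr rfl fun p hp => ?_
      rw [← Finset.sum_filter]
      refine Finset.sum_congr ?_ fun _ _ => rfl
      ext m
      have hp0 := hP0 p hp
      rw [Finset.mem_filter, Finset.mem_Ioc, Finset.mem_Ioc, Nat.le_div_iff_mul_le hp0, mul_comm m]
      constructor
      · rintro ⟨h1, h2⟩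
        exact ⟨h1.1, h2⟩
      · rintro ⟨h1, h2⟩
        exact ⟨⟨h1, (Nat.le_mul_of_pos_left m hp0).trans h2⟩, h2⟩
    rw [e, ← Finset.sum_sub_distrib, hV, Finset.mul_sum]
    refine (norm_sum_le _ _).trans (Finset.sum_le_sum fun p hp => ?_)
    have hp0 := hP0 p hp
    rw [← Finset.sum_sub_distrib]
    calc ‖∑ m ∈ Finset.Ioc 0 (N / p), (a (p * m) - (ψ (p * m - (m.primeFactors.card + 1)) - c))‖
        ≤ ∑ m ∈ Finset.Ioc 0 (N / p), if p ∣ m then (2 : ℝ) else 0 := by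
          refine (norm_sum_le _ _).trans (Finset.sum_le_sum fun m hm => ?_)
          split_ifs with hpm
          · have : a (p * m) - (ψ (p * m - (m.primeFactors.card + 1)) - c) =
              ψ (p * m - (p * m).primeFactors.card) - ψ (p * m - (m.primeFactors.card + 1)) := by
              simp only [ha]; ring
            rw [this]
            exact (norm_sub_le _ _).trans (by
              linarith [hψ (p * m - (p * m).primeFactors.card),
                hψ (p * m - (m.primeFactors.card + 1))])
          · simp only [ha]
            rw [card_primeFactors_prime_mul (hP p hp) hpm]
            simp
      _ = 2 * ((N / p / p : ℕ) : ℝ) := by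
          rw [← Finset.sum_filter, Finset.sum_const, card_filter_dvd_Ioc, nsmul_eq_mul, mul_comm]
      _ ≤ 2 * ((N : ℝ) / p / p) := by
          gcongr
          refine (@Nat.cast_div_le ℝ _ _ _ (N / p) p).trans ?_
          gcongr
          exact @Nat.cast_div_le ℝ _ _ _ N p
      _ = _ := by ring
  have h3 : ‖∑ m ∈ Finset.Ioc 0 N, S (m.primeFactors.card + 1) m‖ ≤
      N * √(H * (K * (4 * V + 2 * ε * W ^ 2))) := by
    have hSk : ∀ k ∈ Finset.Icc 1 K, ∑ m ∈ Finset.Ioc 0 N, (m : ℝ) * ‖S k m‖ ^ 2 ≤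
        N ^ 2 * (4 * V + 2 * ε * W ^ 2) := fun k hk =>
      sum_mul_sq_norm_sum_le hψ hc hP0 k hε (hcorr k hk)
    calc ‖∑ m ∈ Finset.Ioc 0 N, S (m.primeFactors.card + 1) m‖
        ≤ ∑ m ∈ Finset.Ioc 0 N, (1 / √m) * (√m * ‖S (m.primeFactors.card + 1) m‖) := by
          refine (norm_sum_le _ _).trans (le_of_eq (Finset.sum_congr rfl fun m hm => ?_))
          have : √(m : ℝ) ≠ 0 :=
            (Real.sqrt_pos.2 (by exact_mod_cast (Finset.mem_Ioc.1 hm).1)).ne'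
          field_simp
      _ ≤ √(∑ m ∈ Finset.Ioc 0 N, (1 / √m) ^ 2) *
          √(∑ m ∈ Finset.Ioc 0 N, (√m * ‖S (m.primeFactors.card + 1) m‖) ^ 2) := hcs _ _
      _ ≤ √H * √(K * (N ^ 2 * (4 * V + 2 * ε * W ^ 2))) := by
          gcongr
          · refine le_trans (le_of_eq (Finset.sum_congr rfl fun m _ => ?_)) hH
            rw [div_pow, Real.sq_sqrt (by positivity), one_pow]
          · calc ∑ m ∈ Finset.Ioc 0 N, (√m * ‖S (m.primeFactors.card + 1) m‖) ^ 2
                ≤ ∑ m ∈ Finset.Ioc 0 N, ∑ k ∈ Finset.Icc 1 K, (m : ℝ) * ‖S k m‖ ^ 2 := by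
                  refine Finset.sum_le_sum fun m hm => ?_
                  rw [mul_pow, Real.sq_sqrt (by positivity)]
                  exact Finset.single_le_sum (f := fun k => (m : ℝ) * ‖S k m‖ ^ 2)
                    (fun k _ => by positivity)
                    (Finset.mem_Icc.2 ⟨by omega, hK m hm⟩)
              _ = ∑ k ∈ Finset.Icc 1 K, ∑ m ∈ Finset.Ioc 0 N, (m : ℝ) * ‖S k m‖ ^ 2 :=
                  Finset.sum_comm
              _ ≤ ∑ k ∈ Finset.Icc 1 K, (N : ℝ) ^ 2 * (4 * V + 2 * ε * W ^ 2) :=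
                  Finset.sum_le_sum hSk
              _ = _ := by simp
      _ = _ := by
          have hH0 : 0 ≤ H := le_trans (Finset.sum_nonneg fun m _ => by positivity) hH
          rw [← Real.sqrt_mul hH0]
          have : H * (K * (N ^ 2 * (4 * V + 2 * ε * W ^ 2))) =
            N ^ 2 * (H * (K * (4 * V + 2 * ε * W ^ 2))) := by ring
          rw [this, Real.sqrt_mul (by positivity), Real.sqrt_sq (by positivity)]
  have hl : W * ‖∑ n ∈ Finset.Ioc 0 N, a n‖ = ‖(W : ℂ) * ∑ n ∈ Finset.Ioc 0 N, a n‖ := by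
    rw [norm_mul, Complex.norm_real, Real.norm_of_nonneg hW0]
  rw [hl, hsplit]
  refine (norm_add_le _ _).trans (add_le_add ((norm_add_le _ _).trans (add_le_add h1 h2)) h3)

end Katai

lemma card_primeFactors_le_two_mul_log {m : ℕ} (hm : 1 ≤ m) :
    (m.primeFactors.card : ℝ) ≤ 2 * Real.log m := by
  have h1 : 2 ^ m.primeFactors.card ≤ m := by
    calc 2 ^ m.primeFactors.card ≤ ∏ p ∈ m.primeFactors, p :=
          Finset.pow_card_le_prod _ _ _ fun p hp => (Nat.prime_of_mem_primeFactors hp).two_le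
      _ ≤ m := Nat.le_of_dvd hm (Nat.prod_primeFactors_dvd m)
  have h2 : ((2 : ℝ) ^ m.primeFactors.card) ≤ m := by exact_mod_cast h1
  have h3 := Real.log_le_log (by positivity) h2
  rw [Real.log_pow] at h3
  have := Real.log_two_gt_d9
  have h4 : (0 : ℝ) ≤ m.primeFactors.card := by positivity
  nlinarith

lemma card_filter_modEq_le {Q : Finset ℕ} (hQ : ∀ q ∈ Q, q.Prime) {p p' : ℕ} (h : p ≠ p')
    {Y : ℝ} (hp : (p : ℝ) ≤ Y) (hp' : (p' : ℝ) ≤ Y) :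
    ((Q.filter fun q => p ≡ p' [MOD q]).card : ℝ) ≤ 2 * Real.log Y := by
  wlog hlt : p < p' generalizing p p'
  · have := this h.symm hp' hp (by omega)
    simpa only [Nat.ModEq.comm (a := p) (b := p')] using this
  have hsub : (Q.filter fun q => p ≡ p' [MOD q]) ⊆ (p' - p).primeFactors := by
    intro q hq
    rw [Finset.mem_filter] at hq
    rw [Nat.mem_primeFactors]
    exact ⟨hQ q hq.1, (Nat.modEq_iff_dvd' hlt.le).1 hq.2, by omega⟩
  have h1 : ((Q.filter fun q => p ≡ p' [MOD q]).card : ℝ) ≤ ((p' - p).primeFactors.card : ℝ) := by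
    exact_mod_cast Finset.card_le_card hsub
  refine h1.trans ((card_primeFactors_le_two_mul_log (by omega)).trans ?_)
  have h2 : ((p' - p : ℕ) : ℝ) ≤ Y := by
    refine le_trans ?_ hp'
    exact_mod_cast Nat.sub_le _ _
  have h3 : (0 : ℝ) < ((p' - p : ℕ) : ℝ) := by
    have : 0 < p' - p := by omega
    exact_mod_cast this
  gcongr

/-- The primes in `((log x) ^ 5, exp (log x / (log log x) ^ 3)]`. -/
noncomputable def midPrimes (x : ℝ) : Finset ℕ :=
  primesIoc ⌊Real.log x ^ 5⌋₊ ⌊Real.exp (Real.log x / Real.log (Real.log x) ^ 3)⌋₊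

/-- The primes in `(exp (log x / (log log x) ^ 3), x ^ (1 / 4)]`. -/
noncomputable def largePrimes (x : ℝ) : Finset ℕ :=
  primesIoc ⌊Real.exp (Real.log x / Real.log (Real.log x) ^ 3)⌋₊ ⌊Real.exp (Real.log x / 4)⌋₊

set_option maxHeartbeats 1000000 in
open ComplexConjugate in
lemma norm_sum_twist_midPrimes_sub_le {x t l L W : ℝ} {h : ℂ} (hl : l = Real.log x)
    (hL : L = Real.log l) (hW : W = ∑ p ∈ largePrimes x, (1 : ℝ) / p) (hx : 0 < x)
    (hh : ‖1 + h‖ = 1) (hht : ‖h‖ ≤ |t| / √L) (hL1 : 1 ≤ L) (hLl : L ≤ l)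
    (htL : |t| ≤ √L) (hlogL : 8 * |t| + 10 ≤ Real.log L) (hL32 : 32 ≤ L ^ 2)
    (hzz : 5 * L ≤ l / L ^ 3) (hexp : 12 * (2 * l + 2) * l ^ 4 ≤ Real.exp (5 * l / 8))
    (hQs : ∑ q ∈ midPrimes x, (1 : ℝ) / q ≤ 2 * L) (hW1 : 1 ≤ W) (hWL : W ≤ L)
    (hsmall : 6 * l ^ 2 * (4 * L / l ^ 5 + 32 * L ^ 2 / l ^ 4) ≤ 1) :
    ‖∑ n ∈ Finset.Ioc 0 ⌊x⌋₊, (twist (midPrimes x) h (n - n.primeFactors.card) -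
      twistMean (midPrimes x) h)‖ ≤ 7 * ⌊x⌋₊ / √W := by
  set Q := midPrimes x with hQdef
  set P := largePrimes x with hPdef
  set z := Real.exp (l / L ^ 3) with hz
  set N := ⌊x⌋₊ with hN
  have hl0 : 0 < l := by linarith
  have hlexp : l = Real.exp L := by rw [hL, Real.exp_log hl0]
  have hxexp : x = Real.exp l := by rw [hl, Real.exp_log hx]
  have hl2 : 2 ≤ l := by
    rw [hlexp]; linarith [Real.add_one_le_exp L]
  have hlz : l ^ 5 ≤ z := by
    have : l ^ 5 = Real.exp (5 * L) := by
      rw [hlexp, ← Real.exp_nat_mul]; push_cast; rfl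
    rw [this, hz]
    exact Real.exp_le_exp.2 hzz
  have hl5 : 0 < l ^ 5 := by positivity
  have hz0 : 0 < z := Real.exp_pos _
  have hl5l : 3 * l < l ^ 5 := by
    have : (16 : ℝ) ≤ l ^ 4 := by
      calc (16 : ℝ) = 2 ^ 4 := by norm_num
        _ ≤ l ^ 4 := by gcongr
    calc 3 * l < 16 * l := by linarith
      _ ≤ l ^ 4 * l := by gcongr
      _ = l ^ 5 := by ring
  have hQmem : ∀ q ∈ Q, q.Prime ∧ l ^ 5 < q ∧ (q : ℝ) ≤ z := by
    intro q hq
    rw [hQdef, midPrimes, mem_primesIoc, ← hl, ← hL] at hq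
    exact ⟨hq.2, Nat.lt_of_floor_lt hq.1.1, (Nat.le_floor_iff hz0.le).1 hq.1.2⟩
  have hPmem : ∀ p ∈ P, p.Prime ∧ z < p ∧ (p : ℝ) ≤ Real.exp (l / 4) := by
    intro p hp
    rw [hPdef, largePrimes, mem_primesIoc, ← hl, ← hL] at hp
    exact ⟨hp.2, Nat.lt_of_floor_lt hp.1.1, (Nat.le_floor_iff (Real.exp_pos _).le).1 hp.1.2⟩
  have hQ : ∀ q ∈ Q, q.Prime := fun q hq => (hQmem q hq).1
  have hP : ∀ p ∈ P, p.Prime := fun p hp => (hPmem p hp).1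
  have hNx : (N : ℝ) ≤ x := Nat.floor_le hx.le
  have hx2 : 2 ≤ x := by rw [hxexp]; linarith [Real.add_one_le_exp l]
  have hNx2 : x / 2 ≤ N := by
    have := Nat.lt_floor_add_one x
    linarith
  have hN0 : (0 : ℝ) < N := by linarith
  have hlogN : ∀ m ∈ Finset.Ioc 0 N, Real.log m ≤ l := by
    intro m hm
    rw [Finset.mem_Ioc] at hm
    rw [hl]
    apply Real.log_le_log (by exact_mod_cast hm.1)
    exact le_trans (by exact_mod_cast hm.2) hNx
  have hNmem : N ∈ Finset.Ioc 0 N := by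
    rw [Finset.mem_Ioc]; exact ⟨by exact_mod_cast hN0, le_rfl⟩
  have hH : ∑ m ∈ Finset.Ioc 0 N, (1 : ℝ) / m ≤ 2 * l := by
    have h1 := harmonic_le_one_add_log N
    have h2 := hlogN N hNmem
    have h3 : ∑ m ∈ Finset.Ioc 0 N, (1 : ℝ) / m = (harmonic N : ℝ) := by
      rw [harmonic_eq_sum_Icc]
      push_cast
      refine Finset.sum_congr rfl fun m _ => by rw [one_div]
    rw [h3]; linarith
  set K := ⌊2 * l⌋₊ + 1 with hK
  have hKl : (K : ℝ) ≤ 3 * l := by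
    have := Nat.floor_le (show 0 ≤ 2 * l by linarith)
    rw [hK]; push_cast; linarith
  have hKω : ∀ m ∈ Finset.Ioc 0 N, m.primeFactors.card + 1 ≤ K := by
    intro m hm
    have h1 := card_primeFactors_le_two_mul_log (Finset.mem_Ioc.1 hm).1
    have h2 := hlogN m hm
    rw [hK, add_le_add_iff_right]
    exact Nat.le_floor (by linarith)
  have hh1 : ‖h‖ ≤ 1 := by
    refine hht.trans ((div_le_one (by positivity)).2 htL)
  have hsL : 0 < √L := Real.sqrt_pos.2 (by linarith)
  have hs : 2 * ‖h‖ * ∑ q ∈ Q, (1 : ℝ) / q ≤ 4 * |t| * √L := by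
    calc 2 * ‖h‖ * ∑ q ∈ Q, (1 : ℝ) / q ≤ 2 * (|t| / √L) * (2 * L) := by
          gcongr
      _ = 4 * |t| * (L / √L) := by ring
      _ = 4 * |t| * √L := by rw [Real.div_sqrt]
  set R := ⌈L⌉₊ with hR
  set T := ⌊z⌋₊ with hT
  have hT1 : 1 ≤ T := by
    rw [hT, Nat.one_le_floor_iff, hz]
    exact Real.one_le_exp (by positivity)
  have hQT : Q ⊆ Finset.Icc 1 T := by
    intro q hq
    rw [Finset.mem_Icc]
    exact ⟨(hQ q hq).one_lt.le, Nat.le_floor (hQmem q hq).2.2⟩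
  have hRle : (R : ℝ) ≤ 2 * L := by
    have := Nat.ceil_lt_add_one (show 0 ≤ L by linarith)
    linarith
  have hE : Real.exp (√L * (4 * |t| * √L)) / √L ^ R ≤ 1 / l ^ 5 := by
    have e1 : √L * (4 * |t| * √L) = 4 * |t| * L := by
      have := Real.mul_self_sqrt (show 0 ≤ L by linarith)
      linear_combination 4 * |t| * this
    have e2 : √L = Real.exp (Real.log L / 2) := by
      rw [← Real.log_sqrt (by linarith), Real.exp_log hsL]
    have e3 : Real.exp (Real.log L / 2 * L) ≤ √L ^ R := by
      rw [e2, ← Real.exp_nat_mul]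
      apply Real.exp_le_exp.2
      have := Nat.le_ceil L
      have h2 : 0 ≤ Real.log L / 2 := by linarith [abs_nonneg t]
      rw [mul_comm]
      exact mul_le_mul_of_nonneg_right this h2
    have e4 : l ^ 5 = Real.exp (5 * L) := by
      rw [hlexp, ← Real.exp_nat_mul]; push_cast; rfl
    rw [e1, e4, div_le_div_iff₀ (by positivity) (by positivity), one_mul, ← Real.exp_add]
    refine le_trans (Real.exp_le_exp.2 ?_) e3
    have := mul_le_mul_of_nonneg_right hlogL (show 0 ≤ L by linarith)
    linarith
  have hTR : (T : ℝ) ^ (2 * R) ≤ Real.exp (l / 8) := by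
    calc (T : ℝ) ^ (2 * R) ≤ z ^ (2 * R) := by
          gcongr
          exact Nat.floor_le hz0.le
      _ = Real.exp ((2 * R : ℕ) * (l / L ^ 3)) := by rw [Real.exp_nat_mul]
      _ ≤ Real.exp (l / 8) := by
          apply Real.exp_le_exp.2
          push_cast
          calc 2 * (R : ℝ) * (l / L ^ 3) ≤ 2 * (2 * L) * (l / L ^ 3) := by gcongr
            _ = 4 * l / L ^ 2 := by field_simp; norm_num
            _ ≤ 4 * l / 32 := by gcongr
            _ = l / 8 := by ring
  set ε := 16 / l ^ 4 with hε
  have hcorr : ∀ k ∈ Finset.Icc 1 K, ∀ p ∈ P, ∀ p' ∈ P, p ≠ p' → ∀ M ≤ N / p, M ≤ N / p' →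
      ‖∑ m ∈ Finset.Ioc 0 M, (twist Q h (p * m - k) - twistMean Q h) *
        conj (twist Q h (p' * m - k) - twistMean Q h)‖ ≤ ε * (N / p') := by
    intro k hk p hp p' hp' hpp M _ hM'
    rw [Finset.mem_Icc] at hk
    have hk3 : (k : ℝ) ≤ 3 * l := le_trans (by exact_mod_cast hk.2) hKl
    have hkP : ∀ p ∈ P, k ≤ p := by
      intro p hp
      have h1 := (hPmem p hp).2.1
      have : (k : ℝ) ≤ p := by linarith
      exact_mod_cast this
    have hcop : ∀ p ∈ P, ∀ q ∈ Q, p.Coprime q := by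
      intro p hp q hq
      rw [Nat.coprime_primes (hP p hp) (hQ q hq)]
      rintro rfl
      linarith [(hPmem p hp).2.1, (hQmem p hq).2.2]
    have hkQ : ∀ q ∈ Q, k < q := by
      intro q hq
      have : (k : ℝ) < q := by linarith [(hQmem q hq).2.1]
      exact_mod_cast this
    have hmain := norm_sum_centered_correlation_le hQ hT1 hQT hh hh1 hk.1 hkQ (hkP p hp)
      (hkP p' hp') (hcop p hp) (hcop p' hp') M R hsL hs hl5 (fun q hq => (hQmem q hq).2.1.le)
    refine hmain.trans ?_
    have hp'0 : (0 : ℝ) < p' := by exact_mod_cast (hP p' hp').pos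
    have hD : Real.exp (3 * l / 4) / 2 ≤ (N : ℝ) / p' := by
      rw [le_div_iff₀ hp'0]
      calc Real.exp (3 * l / 4) / 2 * p' ≤ Real.exp (3 * l / 4) / 2 * Real.exp (l / 4) := by
            gcongr
            exact (hPmem p' hp').2.2
        _ = Real.exp (3 * l / 4 + l / 4) / 2 := by rw [Real.exp_add]; ring
        _ = x / 2 := by rw [hxexp]; congr 2; ring
        _ ≤ N := hNx2
    set D := (N : ℝ) / p' with hDdef
    have hMD : (M : ℝ) ≤ D := le_trans (by exact_mod_cast hM') (@Nat.cast_div_le ℝ _ _ _ N p')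
    have hD1 : 1 ≤ D := by linarith [Real.add_one_le_exp (3 * l / 4)]
    have hδ : (∑ q ∈ Q, (1 : ℝ) / q + (Q.filter fun q => p ≡ p' [MOD q]).card) / l ^ 5 ≤
        3 / l ^ 4 := by
      have h1 := card_filter_modEq_le hQ hpp (hPmem p hp).2.2 (hPmem p' hp').2.2
      rw [Real.log_exp] at h1
      rw [div_le_div_iff₀ hl5 (by positivity)]
      have h2 : ∑ q ∈ Q, (1 : ℝ) / q + (Q.filter fun q => p ≡ p' [MOD q]).card ≤ 3 * l := by
        linarith
      calc _ ≤ 3 * l * l ^ 4 := by gcongr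
        _ = _ := by ring
    have hA : 3 * (2 * ((R + 1) * (T : ℝ) ^ (2 * R)) + 2) ≤ D / l ^ 4 := by
      rw [le_div_iff₀ (by positivity)]
      have h1 : (1 : ℝ) ≤ Real.exp (l / 8) := Real.one_le_exp (by positivity)
      have h2 : 3 * (2 * ((R + 1) * (T : ℝ) ^ (2 * R)) + 2) ≤
          6 * (2 * l + 2) * Real.exp (l / 8) := by
        have : ((R : ℝ) + 1) * (T : ℝ) ^ (2 * R) ≤ (2 * l + 1) * Real.exp (l / 8) := by
          gcongr
          linarith
        linarith
      calc 3 * (2 * ((R + 1) * (T : ℝ) ^ (2 * R)) + 2) * l ^ 4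
          ≤ 6 * (2 * l + 2) * Real.exp (l / 8) * l ^ 4 := by gcongr
        _ = (12 * (2 * l + 2) * l ^ 4) * Real.exp (l / 8) / 2 := by ring
        _ ≤ Real.exp (5 * l / 8) * Real.exp (l / 8) / 2 := by gcongr
        _ = Real.exp (5 * l / 8 + l / 8) / 2 := by rw [Real.exp_add]
        _ ≤ Real.exp (3 * l / 4) / 2 := by
            gcongr
            linarith
        _ ≤ D := hD
    have hB : 3 * (2 * (M + 1 : ℕ) * (Real.exp (√L * (4 * |t| * √L)) / √L ^ R)) ≤
        12 * D / l ^ 4 := by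
      have h1 : ((M + 1 : ℕ) : ℝ) ≤ 2 * D := by push_cast; linarith
      have h2 : 1 / l ^ 5 ≤ 1 / l ^ 4 :=
        one_div_le_one_div_of_le (by positivity) (pow_le_pow_right₀ (by linarith) (by norm_num))
      calc 3 * (2 * ((M + 1 : ℕ) : ℝ) * (Real.exp (√L * (4 * |t| * √L)) / √L ^ R))
          ≤ 3 * (2 * (2 * D) * (1 / l ^ 4)) := by
            refine mul_le_mul_of_nonneg_left (mul_le_mul (by linarith) (hE.trans h2)
              (by positivity) (by positivity)) (by norm_num)
        _ = _ := by ring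
    have hC : (M : ℝ) * ((∑ q ∈ Q, (1 : ℝ) / q + (Q.filter fun q => p ≡ p' [MOD q]).card) /
        l ^ 5) ≤ D * (3 / l ^ 4) :=
      mul_le_mul hMD hδ (div_nonneg (add_nonneg (Finset.sum_nonneg fun q _ => by positivity)
        (Nat.cast_nonneg _)) hl5.le) (by linarith)
    have hfin : ε * D = 12 * D / l ^ 4 + D / l ^ 4 + D * (3 / l ^ 4) := by rw [hε]; ring
    rw [hfin]
    linarith
  have hkatai := norm_sum_sub_card_primeFactors_le (fun n => norm_twist_le hh Q n)
    (norm_twistMean_le hh hQ) hP hKω (by positivity) hH hcorr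
  rw [← hW] at hkatai
  set V := ∑ p ∈ P, (1 / (p : ℝ)) ^ 2 with hV
  have hV0 : 0 ≤ V := Finset.sum_nonneg fun p _ => by positivity
  have hVle : V ≤ L / l ^ 5 := by
    calc V ≤ ∑ p ∈ P, (1 / (p : ℝ)) * (1 / l ^ 5) := by
          refine Finset.sum_le_sum fun p hp => ?_
          rw [sq]
          gcongr
          linarith [(hPmem p hp).2.1]
      _ = W / l ^ 5 := by rw [← Finset.sum_mul, ← hW]; ring
      _ ≤ L / l ^ 5 := by gcongr
  have hV1 : V ≤ 1 := by
    refine hVle.trans ((div_le_one hl5).2 ?_)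
    linarith
  have hcard : (P.card : ℝ) ≤ N := by
    have h1 : P ⊆ Finset.Ioc 0 N := by
      intro p hp
      have h2 := (hPmem p hp).2.2
      rw [Finset.mem_Ioc]
      refine ⟨(hP p hp).pos, Nat.le_floor (h2.trans ?_)⟩
      rw [hxexp]
      exact Real.exp_le_exp.2 (by linarith)
    have h2 := Finset.card_le_card h1
    rw [Nat.card_Ioc, Nat.sub_zero] at h2
    exact_mod_cast h2
  have hW0 : 0 < W := by linarith
  have hsW : 1 ≤ √W := Real.one_le_sqrt.2 hW1
  have hsW2 : √W * √W = W := Real.mul_self_sqrt hW0.le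
  have b1 : 2 * √(N : ℝ) * √(N * W + 2 * W * P.card) ≤ 4 * N * √W := by
    have : (N : ℝ) * W + 2 * W * P.card ≤ 2 ^ 2 * (N * W) := by
      have h1 := mul_le_mul_of_nonneg_left hcard hW0.le
      have h2 : 0 ≤ N * W := by positivity
      linarith
    calc 2 * √(N : ℝ) * √(N * W + 2 * W * P.card) ≤ 2 * √(N : ℝ) * √(2 ^ 2 * (N * W)) := by
          gcongr
      _ = 4 * (√(N : ℝ) * √(N : ℝ)) * √W := by
          rw [Real.sqrt_mul (by norm_num), Real.sqrt_sq (by norm_num), Real.sqrt_mul hN0.le]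
          ring
      _ = _ := by rw [Real.mul_self_sqrt hN0.le]
  have b2 : 2 * (N : ℝ) * V ≤ 2 * N * √W := by
    gcongr
    linarith
  have b3 : (N : ℝ) * √(2 * l * (K * (4 * V + 2 * ε * W ^ 2))) ≤ N * √W := by
    gcongr
    refine le_trans ?_ hW1
    refine le_trans ?_ hsmall
    calc 2 * l * (K * (4 * V + 2 * ε * W ^ 2))
        ≤ 2 * l * (3 * l * (4 * (L / l ^ 5) + 2 * ε * L ^ 2)) := by gcongr
      _ = _ := by rw [hε]; ring
  rw [le_div_iff₀ (by linarith)]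
  have : √W * (‖∑ n ∈ Finset.Ioc 0 N, (twist Q h (n - n.primeFactors.card) -
      twistMean Q h)‖ * √W) ≤ √W * (7 * N) := by
    calc _ = √W * √W * ‖∑ n ∈ Finset.Ioc 0 N, (twist Q h (n - n.primeFactors.card) -
          twistMean Q h)‖ := by ring
      _ ≤ √W * (7 * N) := by
        rw [hsW2]
        linarith
  exact le_of_mul_le_mul_left this (by linarith)

lemma tendsto_log_log_atTop : Tendsto (fun x : ℝ => Real.log (Real.log x)) atTop atTop :=
  Real.tendsto_log_atTop.comp Real.tendsto_log_atTop

lemma eventually_mul_pow_le_exp (a : ℝ) (n : ℕ) : ∀ᶠ x : ℝ in atTop, a * x ^ n ≤ Real.exp x := by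
  have h := (Real.tendsto_pow_mul_exp_neg_atTop_nhds_zero n).const_mul a
  rw [mul_zero] at h
  filter_upwards [h.eventually (ge_mem_nhds zero_lt_one)] with x hx
  rw [Real.exp_neg, ← mul_assoc, ← div_eq_mul_inv, div_le_one (Real.exp_pos x)] at hx
  exact hx

lemma eventually_five_mul_le_div_pow :
    ∀ᶠ x : ℝ in atTop, 5 * Real.log (Real.log x) ≤
      Real.log x / Real.log (Real.log x) ^ 3 := by
  filter_upwards [tendsto_log_log_atTop.eventually (eventually_mul_pow_le_exp 5 4),
    tendsto_log_log_atTop.eventually_ge_atTop 1,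
    Real.tendsto_log_atTop.eventually_gt_atTop 0] with x h1 h2 h3
  rw [Real.exp_log h3] at h1
  rw [le_div_iff₀ (by positivity)]
  calc _ = 5 * Real.log (Real.log x) ^ 4 := by ring
    _ ≤ _ := h1

lemma exists_mertens_bounds : ∃ C : ℝ, 0 ≤ C ∧ ∀ᶠ x : ℝ in atTop,
    |∑ q ∈ midPrimes x, (1 : ℝ) / q - Real.log (Real.log x)| ≤
      4 * Real.log (Real.log (Real.log x)) + C ∧
    |∑ p ∈ largePrimes x, (1 : ℝ) / p - 3 * Real.log (Real.log (Real.log x))| ≤ C ∧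
    primeRecip x ≤ Real.log (Real.log x) + C := by
  obtain ⟨C, hC0, hC⟩ := exists_primeRecip_bound
  refine ⟨2 * C + 4, by linarith, ?_⟩
  filter_upwards [eventually_five_mul_le_div_pow,
    tendsto_log_log_atTop.eventually_ge_atTop 2,
    Real.tendsto_log_atTop.eventually_ge_atTop 4, eventually_ge_atTop 2] with x h1 h2 h3 h4
  set l := Real.log x with hl
  set L := Real.log l with hL
  have hl0 : 0 < l := by linarith
  have hlexp : l = Real.exp L := by rw [hL, Real.exp_log hl0]
  have hl5 : l ^ 5 = Real.exp (5 * L) := by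
    rw [hlexp, ← Real.exp_nat_mul]; push_cast; rfl
  have e2 : (2 : ℝ) ≤ Real.exp (5 * L) := by linarith [Real.add_one_le_exp (5 * L)]
  have hzz : Real.exp (5 * L) ≤ Real.exp (l / L ^ 3) := Real.exp_le_exp.2 h1
  have hL3 : (4 : ℝ) ≤ L ^ 3 := by
    calc (4 : ℝ) ≤ 2 ^ 3 := by norm_num
      _ ≤ L ^ 3 := by gcongr
  have hzy : Real.exp (l / L ^ 3) ≤ Real.exp (l / 4) := by
    apply Real.exp_le_exp.2
    gcongr
  have m1 := abs_le.1 (hC _ e2)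
  have m2 := abs_le.1 (hC _ (e2.trans hzz))
  have m3 := abs_le.1 (hC _ ((e2.trans hzz).trans hzy))
  have m4 := abs_le.1 (hC _ h4)
  rw [Real.log_exp] at m1 m2 m3
  rw [Real.log_mul (by norm_num) (by linarith)] at m1
  rw [Real.log_div (by linarith) (by positivity), Real.log_pow] at m2
  rw [Real.log_div (by linarith) (by positivity)] at m3
  push_cast at m2
  have l5 : Real.log 5 ≤ 4 := by linarith [Real.log_le_sub_one_of_pos (show (0:ℝ) < 5 by norm_num)]
  have l50 : 0 ≤ Real.log 5 := Real.log_nonneg (by norm_num)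
  have l4 : Real.log 4 ≤ 4 := by linarith [Real.log_le_sub_one_of_pos (show (0:ℝ) < 4 by norm_num)]
  have l40 : 0 ≤ Real.log 4 := Real.log_nonneg (by norm_num)
  have lL : 0 ≤ Real.log L := Real.log_nonneg (by linarith)
  rw [midPrimes, largePrimes, ← hl, ← hL, hl5, sum_primesIoc_eq_sub hzz, sum_primesIoc_eq_sub hzy]
  refine ⟨abs_le.2 ⟨?_, ?_⟩, abs_le.2 ⟨?_, ?_⟩, ?_⟩ <;> linarith

lemma tendsto_log_div_sqrt : Tendsto (fun x : ℝ => Real.log x / √x) atTop (nhds 0) := by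
  have h := (isLittleO_log_rpow_atTop (r := 1 / 2) (by norm_num)).tendsto_div_nhds_zero
  simpa only [← Real.sqrt_eq_rpow] using h

lemma eventually_mul_log_add_le (a b : ℝ) {ε : ℝ} (hε : 0 < ε) :
    ∀ᶠ x : ℝ in atTop, a * Real.log x + b ≤ ε * √x := by
  have h1 : Tendsto (fun x : ℝ => a * (Real.log x / √x) + b * (√x)⁻¹) atTop
      (nhds (a * 0 + b * 0)) :=
    (tendsto_log_div_sqrt.const_mul a).add
      ((tendsto_inv_atTop_zero.comp Real.tendsto_sqrt_atTop).const_mul b)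
  rw [mul_zero, mul_zero, add_zero] at h1
  filter_upwards [h1.eventually (ge_mem_nhds hε), eventually_gt_atTop 0] with x hx hx0
  have hs : 0 < √x := Real.sqrt_pos.2 hx0
  have : a * (Real.log x / √x) + b * (√x)⁻¹ = (a * Real.log x + b) / √x := by
    field_simp
  rw [this, div_le_iff₀ hs] at hx
  exact hx

/-- The increment `h` with `1 + h = exp (i t / √(log log x))`. -/
noncomputable def phase (t x : ℝ) : ℂ :=
  Complex.exp (Complex.I * ((t / √(Real.log (Real.log x)) : ℝ) : ℂ)) - 1

lemma norm_one_add_phase (t x : ℝ) : ‖1 + phase t x‖ = 1 := by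
  rw [phase, add_sub_cancel, mul_comm, Complex.norm_exp_ofReal_mul_I]

lemma norm_phase_le (t x : ℝ) : ‖phase t x‖ ≤ |t| / √(Real.log (Real.log x)) := by
  refine Real.norm_exp_I_mul_ofReal_sub_one_le.trans (le_of_eq ?_)
  rw [Real.norm_eq_abs, abs_div, abs_of_nonneg (Real.sqrt_nonneg _)]

lemma tendsto_average_twist_sub (t : ℝ) : Tendsto (fun x : ℝ =>
    ‖∑ n ∈ Finset.Ioc 0 ⌊x⌋₊, (twist (midPrimes x) (phase t x) (n - n.primeFactors.card) -
      twistMean (midPrimes x) (phase t x))‖ / ⌊x⌋₊) atTop (nhds 0) := by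
  obtain ⟨C, hC0, hC⟩ := exists_mertens_bounds
  have hlogL : Tendsto (fun x : ℝ => Real.log (Real.log (Real.log x))) atTop atTop :=
    Real.tendsto_log_atTop.comp tendsto_log_log_atTop
  have hlim : Tendsto (fun x : ℝ => 7 / √(Real.log (Real.log (Real.log x)))) atTop (nhds 0) :=
    Tendsto.div_atTop tendsto_const_nhds (Real.tendsto_sqrt_atTop.comp hlogL)
  refine tendsto_of_tendsto_of_tendsto_of_le_of_le' tendsto_const_nhds hlim
    (Eventually.of_forall fun x => by positivity) ?_
  filter_upwards [hC, eventually_five_mul_le_div_pow,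
    tendsto_log_log_atTop.eventually_ge_atTop 6,
    tendsto_log_log_atTop.eventually_ge_atTop (|t| ^ 2),
    hlogL.eventually_ge_atTop (8 * |t| + 10), hlogL.eventually_ge_atTop (1 + C),
    tendsto_log_log_atTop.eventually (eventually_mul_log_add_le 4 C zero_lt_one),
    Real.tendsto_log_atTop.eventually (eventually_mul_log_add_le 20 0 zero_lt_one),
    (Real.tendsto_log_atTop.const_mul_atTop (show (0 : ℝ) < 5 / 8 by norm_num)).eventually
      (eventually_mul_pow_le_exp (36 * (8 / 5) ^ 5) 5),
    Real.tendsto_log_atTop.eventually_ge_atTop 6, eventually_gt_atTop 1]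
    with x hx h1 h2 h3 h4 h5 h6 h7 h8 h9 h10
  obtain ⟨c1, c2, -⟩ := hx
  set l := Real.log x with hl
  set L := Real.log l with hL
  rw [abs_le] at c1 c2
  have hsq : √L * √L = L := Real.mul_self_sqrt (by linarith)
  have hs1 : 1 ≤ √L := Real.one_le_sqrt.2 (by linarith)
  have hsL : √L ≤ L := by nlinarith
  have hlogL0 : 0 ≤ Real.log L := by linarith [abs_nonneg t]
  have hsql : √l * √l = l := Real.mul_self_sqrt (by linarith)
  have hLl : L ≤ l := by
    have := Real.log_le_sub_one_of_pos (show 0 < l by linarith)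
    linarith
  have hLl20 : (20 * L) ^ 2 ≤ l := by
    calc (20 * L) ^ 2 ≤ √l ^ 2 := by
          gcongr
          linarith
      _ = l := by rw [sq, hsql]
  set W := ∑ p ∈ largePrimes x, (1 : ℝ) / p with hW
  have hWlog : Real.log L ≤ W := by linarith
  have key := norm_sum_twist_midPrimes_sub_le (t := t) hl hL hW (by linarith)
    (norm_one_add_phase t x) (norm_phase_le t x) (by linarith) hLl
    (Real.le_sqrt_of_sq_le h3) h4 (by nlinarith) h1 ?_ (by linarith)
    (by linarith) (by linarith) ?_
  · have hN : (0 : ℝ) < ⌊x⌋₊ := by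
      have : 0 < ⌊x⌋₊ := Nat.floor_pos.2 h10.le
      exact_mod_cast this
    rw [div_le_iff₀ hN]
    refine key.trans ?_
    have : 0 < √(Real.log L) := Real.sqrt_pos.2 (by linarith [abs_nonneg t])
    calc 7 * (⌊x⌋₊ : ℝ) / √W ≤ 7 * (⌊x⌋₊ : ℝ) / √(Real.log L) := by gcongr
      _ = _ := by ring
  · have e : 5 * l / 8 = 5 / 8 * l := by ring
    rw [e]
    refine le_trans ?_ h8
    have : 36 * (8 / 5) ^ 5 * (5 / 8 * l) ^ 5 = 12 * (3 * l) * l ^ 4 := by ring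
    rw [this]
    gcongr
    linarith
  · have hl0 : 0 < l := by linarith
    have e : 6 * l ^ 2 * (4 * L / l ^ 5 + 32 * L ^ 2 / l ^ 4) =
        (24 * L / l + 192 * L ^ 2) / l ^ 2 := by
      field_simp
      ring
    rw [e, div_le_one (by positivity)]
    have : 24 * L / l ≤ 24 := by
      rw [div_le_iff₀ hl0]
      linarith
    nlinarith

lemma re_phase_nonpos (t x : ℝ) : (phase t x).re ≤ 0 := by
  rw [phase, Complex.sub_re, mul_comm, Complex.exp_ofReal_mul_I_re, Complex.one_re]
  linarith [Real.cos_le_one (t / √(Real.log (Real.log x)))]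

lemma norm_twistMean_sub_exp_le {Q : Finset ℕ} (hQ : ∀ q ∈ Q, q.Prime) {h : ℂ}
    (hh : ‖1 + h‖ = 1) (hh1 : ‖h‖ ≤ 1) (hre : h.re ≤ 0) :
    ‖twistMean Q h - Complex.exp (h * ((∑ q ∈ Q, (1 : ℝ) / q : ℝ) : ℂ))‖ ≤ 2 * ‖h‖ ^ 2 := by
  have e : Complex.exp (h * ((∑ q ∈ Q, (1 : ℝ) / q : ℝ) : ℂ)) =
      ∏ q ∈ Q, Complex.exp (h / q) := by
    rw [← Complex.exp_sum]
    push_cast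
    rw [Finset.mul_sum]
    congr 1
    refine Finset.sum_congr rfl fun q _ => by ring
  rw [e, twistMean]
  refine (norm_prod_sub_prod_le_sum Q _ _
    (fun q hq => norm_one_add_div_le hh (hQ q hq).one_lt.le) ?_).trans ?_
  · intro q _
    rw [Complex.norm_exp, Real.exp_le_one_iff, Complex.div_natCast_re]
    exact div_nonpos_of_nonpos_of_nonneg hre (Nat.cast_nonneg _)
  · have h1 : ∀ q ∈ Q, ‖1 + h / q - Complex.exp (h / q)‖ ≤ ‖h‖ ^ 2 * (1 / (q : ℝ)) ^ 2 := by
      intro q hq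
      have hq1 : (1 : ℝ) ≤ q := by exact_mod_cast (hQ q hq).one_lt.le
      have hle : ‖h / q‖ ≤ 1 := by
        rw [norm_div, RCLike.norm_natCast]
        exact div_le_one_of_le₀ (by linarith) (by linarith)
      have := Complex.norm_exp_sub_one_sub_id_le hle
      rw [← norm_neg]
      have e2 : -(1 + h / q - Complex.exp (h / q)) = Complex.exp (h / q) - 1 - h / q := by ring
      rw [e2]
      refine this.trans (le_of_eq ?_)
      rw [norm_div, RCLike.norm_natCast]
      ring
    refine (Finset.sum_le_sum h1).trans ?_
    rw [← Finset.mul_sum, mul_comm]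
    gcongr
    have hsub : Q ⊆ primesIoc 0 (Q.sup id) := by
      intro q hq
      rw [mem_primesIoc]
      exact ⟨⟨(hQ q hq).pos, Finset.le_sup (f := id) hq⟩, hQ q hq⟩
    exact (Finset.sum_le_sum_of_subset_of_nonneg hsub fun q _ _ => by positivity).trans
      (sum_inv_sq_primes_le _)

lemma tendsto_mul_exp_sub_one_sub (t : ℝ) : Tendsto (fun L : ℝ =>
    (Complex.exp (Complex.I * ((t / √L : ℝ) : ℂ)) - 1) * (L : ℂ) - Complex.I * ((t * √L : ℝ) : ℂ))
    atTop (nhds (-(t : ℂ) ^ 2 / 2)) := by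
  rw [tendsto_iff_norm_sub_tendsto_zero]
  have hlim : Tendsto (fun L : ℝ => |t| ^ 3 * (√L)⁻¹) atTop (nhds 0) := by
    have := (tendsto_inv_atTop_zero.comp Real.tendsto_sqrt_atTop).const_mul (|t| ^ 3)
    rwa [mul_zero] at this
  refine tendsto_of_tendsto_of_tendsto_of_le_of_le' tendsto_const_nhds hlim
    (Eventually.of_forall fun x => by positivity) ?_
  filter_upwards [eventually_ge_atTop (|t| ^ 2), eventually_gt_atTop 0] with L h1 h0
  have hs : 0 < √L := Real.sqrt_pos.2 h0
  have hsq : √L * √L = L := Real.mul_self_sqrt h0.le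
  have hts : |t| ≤ √L := Real.le_sqrt_of_sq_le h1
  set w : ℂ := Complex.I * ((t / √L : ℝ) : ℂ) with hw
  have hwn : ‖w‖ = |t| / √L := by
    rw [hw, norm_mul, Complex.norm_I, one_mul, Complex.norm_real, Real.norm_eq_abs, abs_div,
      abs_of_pos hs]
  have hw1 : ‖w‖ ≤ 1 := by
    rw [hwn]
    exact (div_le_one hs).2 hts
  have hb := Complex.exp_bound hw1 (n := 3) (by norm_num)
  simp only [Finset.sum_range_succ, Finset.sum_range_zero, Nat.factorial] at hb
  have hsC : ((√L : ℝ) : ℂ) ≠ 0 := by exact_mod_cast hs.ne'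
  have hLC : (L : ℂ) = (√L : ℂ) * (√L : ℂ) := by exact_mod_cast hsq.symm
  have e : (Complex.exp w - 1) * (L : ℂ) - Complex.I * ((t * √L : ℝ) : ℂ) - -(t : ℂ) ^ 2 / 2 =
      L * (Complex.exp w - (1 + w + w ^ 2 / 2)) := by
    have e1 : (L : ℂ) * w = Complex.I * ((t * √L : ℝ) : ℂ) := by
      rw [hw, hLC]
      push_cast
      field_simp
    have e2 : (L : ℂ) * w ^ 2 = -(t : ℂ) ^ 2 := by
      rw [hw, hLC, mul_pow, Complex.I_sq]
      push_cast
      field_simp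
    linear_combination e1 + e2 / 2
  rw [e, norm_mul, Complex.norm_real, Real.norm_of_nonneg h0.le]
  have hb' : ‖Complex.exp w - (1 + w + w ^ 2 / 2)‖ ≤ ‖w‖ ^ 3 := by
    refine le_trans (le_of_eq ?_) (hb.trans ?_)
    · congr 1
      norm_num
    · have : (0 : ℝ) ≤ ‖w‖ ^ 3 := by positivity
      norm_num
      linarith
  calc L * ‖Complex.exp w - (1 + w + w ^ 2 / 2)‖ ≤ L * ‖w‖ ^ 3 := by gcongr
    _ = (√L * √L) * (|t| / √L) ^ 3 := by rw [hsq, hwn]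
    _ = |t| ^ 3 * (√L)⁻¹ := by field_simp

lemma tendsto_twistMean_midPrimes (t : ℝ) : Tendsto (fun x : ℝ =>
    Complex.exp (-(Complex.I * ((t * √(Real.log (Real.log x)) : ℝ) : ℂ))) *
      twistMean (midPrimes x) (phase t x)) atTop (nhds (Complex.exp (-(t : ℂ) ^ 2 / 2))) := by
  obtain ⟨C, hC0, hC⟩ := exists_mertens_bounds
  have hQ : ∀ x, ∀ q ∈ midPrimes x, q.Prime := fun x q hq => (mem_primesIoc.1 hq).2
  set μ : ℝ → ℝ := fun x => ∑ q ∈ midPrimes x, (1 : ℝ) / q with hμ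
  have hdiff : Tendsto (fun x : ℝ => phase t x * ((μ x - Real.log (Real.log x) : ℝ) : ℂ)) atTop
      (nhds 0) := by
    rw [tendsto_zero_iff_norm_tendsto_zero]
    have hlim : Tendsto (fun L : ℝ => |t| * (4 * (Real.log L / √L) + C * (√L)⁻¹)) atTop
        (nhds 0) := by
      have := ((tendsto_log_div_sqrt.const_mul 4).add
        ((tendsto_inv_atTop_zero.comp Real.tendsto_sqrt_atTop).const_mul C)).const_mul |t|
      simp only [mul_zero, add_zero] at this
      exact this
    refine tendsto_of_tendsto_of_tendsto_of_le_of_le' tendsto_const_nhds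
      (hlim.comp tendsto_log_log_atTop) (Eventually.of_forall fun x => by positivity) ?_
    filter_upwards [hC, tendsto_log_log_atTop.eventually_gt_atTop 0] with x hx h0
    have hs : 0 < √(Real.log (Real.log x)) := Real.sqrt_pos.2 h0
    rw [norm_mul, Complex.norm_real, Real.norm_eq_abs]
    calc ‖phase t x‖ * |μ x - Real.log (Real.log x)| ≤
          |t| / √(Real.log (Real.log x)) * (4 * Real.log (Real.log (Real.log x)) + C) :=
          mul_le_mul (norm_phase_le t x) hx.1 (abs_nonneg _) (by positivity)
      _ = _ := by
          simp only [Function.comp_apply]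
          field_simp
  have hexp : Tendsto (fun x : ℝ =>
      Complex.exp (-(Complex.I * ((t * √(Real.log (Real.log x)) : ℝ) : ℂ))) *
        Complex.exp (phase t x * (μ x : ℂ))) atTop (nhds (Complex.exp (-(t : ℂ) ^ 2 / 2))) := by
    have h1 := hdiff.add ((tendsto_mul_exp_sub_one_sub t).comp tendsto_log_log_atTop)
    rw [zero_add] at h1
    refine ((Complex.continuous_exp.tendsto _).comp h1).congr fun x => ?_
    simp only [Function.comp_apply]
    rw [← Complex.exp_add]
    congr 1
    rw [phase]
    push_cast
    ring
  have herr : Tendsto (fun x : ℝ =>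
      Complex.exp (-(Complex.I * ((t * √(Real.log (Real.log x)) : ℝ) : ℂ))) *
        (twistMean (midPrimes x) (phase t x) - Complex.exp (phase t x * (μ x : ℂ)))) atTop
      (nhds 0) := by
    rw [tendsto_zero_iff_norm_tendsto_zero]
    have hlim : Tendsto (fun L : ℝ => 2 * |t| ^ 2 * L⁻¹) atTop (nhds 0) := by
      have := tendsto_inv_atTop_zero.const_mul (2 * |t| ^ 2)
      rwa [mul_zero] at this
    refine tendsto_of_tendsto_of_tendsto_of_le_of_le' tendsto_const_nhds
      (hlim.comp tendsto_log_log_atTop) (Eventually.of_forall fun x => by positivity) ?_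
    filter_upwards [tendsto_log_log_atTop.eventually_ge_atTop (|t| ^ 2),
      tendsto_log_log_atTop.eventually_gt_atTop 0] with x h1 h0
    have hs : 0 < √(Real.log (Real.log x)) := Real.sqrt_pos.2 h0
    have hp1 : ‖phase t x‖ ≤ 1 :=
      (norm_phase_le t x).trans ((div_le_one hs).2 (Real.le_sqrt_of_sq_le h1))
    have hn : ‖Complex.exp (-(Complex.I * ((t * √(Real.log (Real.log x)) : ℝ) : ℂ)))‖ = 1 := by
      rw [Complex.norm_exp]
      simp
    rw [norm_mul, hn, one_mul]
    refine (norm_twistMean_sub_exp_le (hQ x) (norm_one_add_phase t x) hp1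
      (re_phase_nonpos t x)).trans ?_
    calc 2 * ‖phase t x‖ ^ 2 ≤ 2 * (|t| / √(Real.log (Real.log x))) ^ 2 := by
          gcongr
          exact norm_phase_le t x
      _ = _ := by
          simp only [Function.comp_apply]
          rw [div_pow, Real.sq_sqrt h0.le]
          ring
  have := herr.add hexp
  rw [zero_add] at this
  refine this.congr fun x => ?_
  ring

lemma sum_two_pow_card_filter_dvd_le {P : Finset ℕ} (hP : ∀ p ∈ P, p.Prime) (N : ℕ) :
    ∑ m ∈ Finset.Ioc 0 N, (2 : ℝ) ^ (P.filter (· ∣ m)).card ≤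
      N * Real.exp (∑ p ∈ P, (1 : ℝ) / p) := by
  classical
  have e : ∀ m, (2 : ℝ) ^ (P.filter (· ∣ m)).card =
      ∑ S ∈ P.powerset, if (∏ p ∈ S, p) ∣ m then (1 : ℝ) else 0 := by
    intro m
    rw [← Finset.prod_const, Finset.prod_filter]
    have : ∀ p ∈ P, (if p ∣ m then (2 : ℝ) else 1) = 1 + if p ∣ m then 1 else 0 := by
      intro p _
      split_ifs <;> norm_num
    rw [Finset.prod_congr rfl this, Finset.prod_one_add]
    refine Finset.sum_congr rfl fun S hS => ?_
    rw [Finset.prod_ite_zero]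
    have hS' : ∀ p ∈ S, p.Prime := fun p hp => hP p (Finset.mem_powerset.1 hS hp)
    have hiff : (∀ p ∈ S, p ∣ m) ↔ (∏ p ∈ S, p) ∣ m :=
      ⟨fun h => Finset.prod_primes_dvd m (fun p hp => (hS' p hp).prime) h,
        fun h p hp => (Finset.dvd_prod_of_mem _ hp).trans h⟩
    simp only [hiff, Finset.prod_const_one]
  simp only [e]
  rw [Finset.sum_comm]
  calc ∑ S ∈ P.powerset, ∑ m ∈ Finset.Ioc 0 N, (if (∏ p ∈ S, p) ∣ m then (1 : ℝ) else 0)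
      ≤ ∑ S ∈ P.powerset, (N : ℝ) * ∏ p ∈ S, (1 : ℝ) / p := by
        refine Finset.sum_le_sum fun S _ => ?_
        rw [← Finset.sum_filter, Finset.sum_const, card_filter_dvd_Ioc, nsmul_eq_mul, mul_one]
        refine Nat.cast_div_le.trans (le_of_eq ?_)
        rw [Finset.prod_div_distrib, Finset.prod_const_one]
        push_cast
        ring
    _ = N * ∏ p ∈ P, (1 + (1 : ℝ) / p) := by rw [← Finset.mul_sum, Finset.prod_one_add]
    _ ≤ N * Real.exp (∑ p ∈ P, (1 : ℝ) / p) := by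
        rw [Real.exp_sum]
        gcongr with p hp
        rw [add_comm]
        exact Real.add_one_le_exp _

lemma primeFactors_eq_filter_primesIoc {n N : ℕ} (hn : n ∈ Finset.Ioc 0 N) :
    n.primeFactors = (primesIoc 0 N).filter (· ∣ n) := by
  rw [Finset.mem_Ioc] at hn
  ext p
  rw [Nat.mem_primeFactors, Finset.mem_filter, mem_primesIoc]
  constructor
  · rintro ⟨h1, h2, -⟩
    exact ⟨⟨⟨h1.pos, (Nat.le_of_dvd hn.1 h2).trans hn.2⟩, h1⟩, h2⟩
  · rintro ⟨⟨-, h1⟩, h2⟩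
    exact ⟨h1, h2, hn.1.ne'⟩

lemma sum_card_primeFactors_le (N : ℕ) :
    ∑ n ∈ Finset.Ioc 0 N, (n.primeFactors.card : ℝ) ≤ N * ∑ p ∈ primesIoc 0 N, (1 : ℝ) / p := by
  have e : ∀ n ∈ Finset.Ioc 0 N, (n.primeFactors.card : ℝ) =
      ∑ p ∈ primesIoc 0 N, if p ∣ n then (1 : ℝ) else 0 := by
    intro n hn
    rw [primeFactors_eq_filter_primesIoc hn, Finset.card_filter]
    push_cast
    rfl
  rw [Finset.sum_congr rfl e, Finset.sum_comm, Finset.mul_sum]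
  refine Finset.sum_le_sum fun p _ => ?_
  rw [← Finset.sum_filter, Finset.sum_const, card_filter_dvd_Ioc, nsmul_eq_mul, mul_one,
    mul_one_div]
  exact Nat.cast_div_le

lemma card_primeFactors_lt {n : ℕ} (hn : 0 < n) : n.primeFactors.card < n := by
  calc n.primeFactors.card < 2 ^ n.primeFactors.card := Nat.lt_two_pow_self
    _ ≤ ∏ p ∈ n.primeFactors, p :=
        Finset.pow_card_le_prod _ _ _ fun p hp => (Nat.prime_of_mem_primeFactors hp).two_le
    _ ≤ n := Nat.le_of_dvd hn (Nat.prod_primeFactors_dvd n)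

lemma card_filter_lt_card_filter_dvd_sub_le {P : Finset ℕ} (hP : ∀ p ∈ P, p.Prime) (N J : ℕ)
    (A : ℝ) :
    (((Finset.Ioc 0 N).filter
      (fun n => A < ((P.filter (· ∣ n - n.primeFactors.card)).card : ℝ))).card : ℝ) ≤
      N * (∑ p ∈ primesIoc 0 N, (1 : ℝ) / p) / (J + 1) +
      (J + 1) * ((2 : ℝ) ^ (-A) * (N * Real.exp (∑ p ∈ P, (1 : ℝ) / p))) := by
  classical
  set B := (Finset.Ioc 0 N).filter
    (fun m => A < ((P.filter (· ∣ m)).card : ℝ)) with hB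
  have hBle : (B.card : ℝ) ≤ (2 : ℝ) ^ (-A) * (N * Real.exp (∑ p ∈ P, (1 : ℝ) / p)) := by
    rw [Real.rpow_neg (by norm_num), ← div_eq_inv_mul, le_div_iff₀ (by positivity)]
    refine le_trans ?_ (sum_two_pow_card_filter_dvd_le hP N)
    calc (B.card : ℝ) * (2 : ℝ) ^ A = ∑ m ∈ B, (2 : ℝ) ^ A := by simp
      _ ≤ ∑ m ∈ B, (2 : ℝ) ^ (P.filter (· ∣ m)).card := by
          refine Finset.sum_le_sum fun m hm => ?_
          rw [← Real.rpow_natCast]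
          exact Real.rpow_le_rpow_of_exponent_le (by norm_num) (Finset.mem_filter.1 hm).2.le
      _ ≤ _ := Finset.sum_le_sum_of_subset_of_nonneg (Finset.filter_subset _ _)
          fun _ _ _ => by positivity
  set G := (Finset.Ioc 0 N).filter (fun n => J + 1 ≤ n.primeFactors.card) with hG
  have hGle : (G.card : ℝ) ≤ N * (∑ p ∈ primesIoc 0 N, (1 : ℝ) / p) / (J + 1) := by
    rw [le_div_iff₀ (by positivity)]
    refine le_trans ?_ (sum_card_primeFactors_le N)
    calc (G.card : ℝ) * (J + 1) = ∑ n ∈ G, ((J + 1 : ℕ) : ℝ) := by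
          rw [Finset.sum_const, nsmul_eq_mul]; push_cast; ring
      _ ≤ ∑ n ∈ G, (n.primeFactors.card : ℝ) := by
          refine Finset.sum_le_sum fun n hn => ?_
          exact_mod_cast (Finset.mem_filter.1 hn).2
      _ ≤ _ := Finset.sum_le_sum_of_subset_of_nonneg (Finset.filter_subset _ _)
          fun _ _ _ => by positivity
  have hsub : (Finset.Ioc 0 N).filter
      (fun n => A < ((P.filter (· ∣ n - n.primeFactors.card)).card : ℝ)) ⊆
      G ∪ (Finset.range (J + 1)).biUnion fun k => B.image (· + k) := by
    intro n hn
    rw [Finset.mem_filter] at hn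
    rw [Finset.mem_union]
    by_cases hJ : J + 1 ≤ n.primeFactors.card
    · exact Or.inl (Finset.mem_filter.2 ⟨hn.1, hJ⟩)
    · right
      have hn1 := Finset.mem_Ioc.1 hn.1
      have hlt := card_primeFactors_lt hn1.1
      rw [Finset.mem_biUnion]
      refine ⟨n.primeFactors.card, Finset.mem_range.2 (by omega), ?_⟩
      rw [Finset.mem_image]
      refine ⟨n - n.primeFactors.card, Finset.mem_filter.2 ⟨Finset.mem_Ioc.2 ?_, hn.2⟩, ?_⟩ <;>
        omega
  have h1 := (Finset.card_le_card hsub).trans (Finset.card_union_le _ _)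
  have h2 : ((Finset.range (J + 1)).biUnion fun k => B.image (· + k)).card ≤ (J + 1) * B.card := by
    refine Finset.card_biUnion_le.trans ?_
    refine (Finset.sum_le_sum fun k _ => Finset.card_image_le).trans (le_of_eq ?_)
    simp
  have h3 : (((Finset.Ioc 0 N).filter
      (fun n => A < ((P.filter (· ∣ n - n.primeFactors.card)).card : ℝ))).card : ℝ) ≤
      G.card + (J + 1) * B.card := by
    exact_mod_cast h1.trans (Nat.add_le_add_left h2 _)
  refine h3.trans (add_le_add hGle ?_)
  gcongr

lemma twist_phase (Q : Finset ℕ) (t x : ℝ) (m : ℕ) :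
    twist Q (phase t x) m = Complex.exp (Complex.I *
      ((t / √(Real.log (Real.log x)) * (Q.filter (· ∣ m)).card : ℝ) : ℂ)) := by
  have : ∀ q ∈ Q, (1 + if q ∣ m then phase t x else 0) =
      if q ∣ m then Complex.exp (Complex.I * ((t / √(Real.log (Real.log x)) : ℝ) : ℂ)) else 1 := by
    intro q _
    split_ifs
    · rw [phase]; ring
    · simp
  rw [twist, Finset.prod_congr rfl this, ← Finset.prod_filter, Finset.prod_const,
    ← Complex.exp_nat_mul]
  congr 1
  push_cast
  ring

lemma norm_exp_I_mul_sub_le (a b : ℝ) :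
    ‖Complex.exp (Complex.I * (a : ℂ)) - Complex.exp (Complex.I * (b : ℂ))‖ ≤ |a - b| := by
  have e : Complex.exp (Complex.I * (a : ℂ)) - Complex.exp (Complex.I * (b : ℂ)) =
      Complex.exp (Complex.I * (b : ℂ)) * (Complex.exp (Complex.I * ((a - b : ℝ) : ℂ)) - 1) := by
    rw [mul_sub, ← Complex.exp_add, mul_one]
    congr 2
    push_cast
    ring
  rw [e, norm_mul, mul_comm Complex.I (b : ℂ), Complex.norm_exp_ofReal_mul_I, one_mul]
  exact Real.norm_exp_I_mul_ofReal_sub_one_le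

lemma norm_sum_exp_sub_twist_le {Q : Finset ℕ} {N : ℕ} (hQ : Q ⊆ primesIoc 0 N) (t x : ℝ)
    (J : ℕ) {A : ℝ} (hA : 0 ≤ A) :
    ‖∑ n ∈ Finset.Ioc 0 N, (Complex.exp (Complex.I * ((t / √(Real.log (Real.log x)) *
      (n - n.primeFactors.card).primeFactors.card : ℝ) : ℂ)) -
      twist Q (phase t x) (n - n.primeFactors.card))‖ ≤
    N * (|t| / √(Real.log (Real.log x)) * A) +
      2 * (N * (∑ p ∈ primesIoc 0 N, (1 : ℝ) / p) / (J + 1) +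
      (J + 1) * ((2 : ℝ) ^ (-A) * (N * Real.exp (∑ p ∈ primesIoc 0 N \ Q, (1 : ℝ) / p)))) := by
  classical
  set s := √(Real.log (Real.log x)) with hs
  have hs0 : 0 ≤ s := Real.sqrt_nonneg _
  have hP : ∀ p ∈ primesIoc 0 N \ Q, p.Prime := fun p hp =>
    (mem_primesIoc.1 (Finset.mem_sdiff.1 hp).1).2
  have hbad := card_filter_lt_card_filter_dvd_sub_le hP N J A
  set P := primesIoc 0 N \ Q with hPdef
  have hterm : ∀ n ∈ Finset.Ioc 0 N, ‖Complex.exp (Complex.I * ((t / s *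
      (n - n.primeFactors.card).primeFactors.card : ℝ) : ℂ)) -
      twist Q (phase t x) (n - n.primeFactors.card)‖ ≤ |t| / s * A +
      2 * if A < ((P.filter (· ∣ n - n.primeFactors.card)).card : ℝ) then 1 else 0 := by
    intro n hn
    have hn1 := Finset.mem_Ioc.1 hn
    have hlt := card_primeFactors_lt hn1.1
    set m := n - n.primeFactors.card with hm
    have hmN : m ∈ Finset.Ioc 0 N := Finset.mem_Ioc.2 (by omega)
    rw [twist_phase, ← hs]
    have hA0 : 0 ≤ |t| / s * A := by positivity
    split_ifs with hlarge
    · refine (norm_sub_le _ _).trans ?_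
      rw [mul_comm Complex.I, mul_comm Complex.I, Complex.norm_exp_ofReal_mul_I,
        Complex.norm_exp_ofReal_mul_I]
      linarith
    · refine (norm_exp_I_mul_sub_le _ _).trans ?_
      have hcard : (m.primeFactors.card : ℝ) =
          (Q.filter (· ∣ m)).card + (P.filter (· ∣ m)).card := by
        rw [primeFactors_eq_filter_primesIoc hmN]
        have : (primesIoc 0 N).filter (· ∣ m) = Q.filter (· ∣ m) ∪ P.filter (· ∣ m) := by
          rw [← Finset.filter_union, hPdef, Finset.union_sdiff_of_subset hQ]
        rw [this, Finset.card_union_of_disjoint]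
        · push_cast; rfl
        · exact Finset.disjoint_filter_filter Finset.disjoint_sdiff
      have e : t / s * (m.primeFactors.card : ℝ) - t / s * ((Q.filter (· ∣ m)).card : ℝ) =
          t / s * ((P.filter (· ∣ m)).card : ℝ) := by rw [hcard]; ring
      rw [e, abs_mul, abs_div, abs_of_nonneg hs0, Nat.abs_cast, mul_zero, add_zero]
      gcongr
      exact not_lt.1 hlarge
  refine (norm_sum_le _ _).trans ((Finset.sum_le_sum hterm).trans ?_)
  rw [Finset.sum_add_distrib, Finset.sum_const, Nat.card_Ioc, nsmul_eq_mul, Nat.sub_zero,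
    ← Finset.mul_sum, ← Finset.sum_filter, Finset.sum_const, nsmul_eq_mul, mul_one]
  gcongr

lemma tendsto_truncation_majorant (a C : ℝ) : Tendsto (fun y : ℝ => a / y +
    2 * ((y ^ 4 + C) / y ^ 8 + 2 * y ^ 8 * ((2 : ℝ) ^ (-y) * (Real.exp (2 * C) * y ^ 16))))
    atTop (nhds 0) := by
  have h1 : Tendsto (fun y : ℝ => a * y⁻¹) atTop (nhds (a * 0)) :=
    tendsto_inv_atTop_zero.const_mul a
  have hp : ∀ k : ℕ, k ≠ 0 → Tendsto (fun y : ℝ => (y ^ k)⁻¹) atTop (nhds 0) := fun k hk =>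
    tendsto_inv_atTop_zero.comp (tendsto_pow_atTop hk)
  have h2 := (hp 4 (by norm_num)).add ((hp 8 (by norm_num)).const_mul C)
  have h3 := (tendsto_rpow_mul_exp_neg_mul_atTop_nhds_zero 24 (Real.log 2)
    (Real.log_pos (by norm_num))).const_mul (2 * Real.exp (2 * C))
  have h := h1.add ((h2.add h3).const_mul 2)
  simp only [mul_zero, add_zero] at h
  refine h.congr' ?_
  filter_upwards [eventually_gt_atTop 0] with y hy
  have e1 : y ^ (24 : ℝ) = y ^ 24 := by exact_mod_cast Real.rpow_natCast y 24
  have e2 : (2 : ℝ) ^ (-y) = Real.exp (-Real.log 2 * y) := by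
    rw [Real.rpow_def_of_pos (by norm_num)]
    congr 1
    ring
  rw [e1, e2]
  field_simp

lemma eventually_midPrimes_subset : ∀ᶠ x : ℝ in atTop, midPrimes x ⊆ primesIoc 0 ⌊x⌋₊ := by
  filter_upwards [tendsto_log_log_atTop.eventually_ge_atTop 1, eventually_gt_atTop 1]
    with x h1 h2 q hq
  rw [midPrimes, mem_primesIoc] at hq
  refine mem_primesIoc.2 ⟨⟨hq.2.pos, hq.1.2.trans (Nat.floor_mono ?_)⟩, hq.2⟩
  calc _ ≤ Real.exp (Real.log x) := Real.exp_le_exp.2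
        (div_le_self (Real.log_pos h2).le (one_le_pow₀ h1))
    _ = x := Real.exp_log (by linarith)

lemma tendsto_average_exp_sub_twist (t : ℝ) : Tendsto (fun x : ℝ =>
    ‖∑ n ∈ Finset.Ioc 0 ⌊x⌋₊, (Complex.exp (Complex.I * ((t / √(Real.log (Real.log x)) *
      (n - n.primeFactors.card).primeFactors.card : ℝ) : ℂ)) -
      twist (midPrimes x) (phase t x) (n - n.primeFactors.card))‖ / ⌊x⌋₊) atTop (nhds 0) := by
  obtain ⟨C, hC0, hC⟩ := exists_mertens_bounds
  refine squeeze_zero' (Eventually.of_forall fun x => by positivity) ?_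
    ((tendsto_truncation_majorant |t| C).comp (Real.tendsto_sqrt_atTop.comp
      (Real.tendsto_sqrt_atTop.comp tendsto_log_log_atTop)))
  filter_upwards [hC, eventually_midPrimes_subset, tendsto_log_log_atTop.eventually_ge_atTop 1,
    eventually_ge_atTop 1] with x hx1 hsub hL hx
  obtain ⟨hmid, -, hall⟩ := hx1
  have hN : (0 : ℝ) < ⌊x⌋₊ := by exact_mod_cast Nat.floor_pos.2 hx
  have hmain := norm_sum_exp_sub_twist_le hsub t x ⌊Real.log (Real.log x) ^ 2⌋₊
    (Real.sqrt_nonneg (√(Real.log (Real.log x))))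
  have hsum : ∑ p ∈ primesIoc 0 ⌊x⌋₊ \ midPrimes x, (1 : ℝ) / p ≤
      4 * Real.log (Real.log (Real.log x)) + 2 * C := by
    have := Finset.sum_sdiff (f := fun p : ℕ => (1 : ℝ) / p) hsub
    have h2 := (abs_le.1 hmid).1
    rw [primeRecip] at hall
    linarith
  rw [primeRecip] at hall
  simp only [Function.comp]
  set L := Real.log (Real.log x) with hLdef
  set y := √(√L) with hy
  have hy0 : 0 < y := Real.sqrt_pos.2 (Real.sqrt_pos.2 (by linarith))
  have hs : √L = y ^ 2 := (Real.sq_sqrt (Real.sqrt_nonneg L)).symm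
  have hLy : L = y ^ 4 := by
    rw [← Real.sq_sqrt (show 0 ≤ L by linarith), hs]
    ring
  have hexp : Real.exp (∑ p ∈ primesIoc 0 ⌊x⌋₊ \ midPrimes x, (1 : ℝ) / p) ≤
      Real.exp (2 * C) * y ^ 16 := by
    refine (Real.exp_le_exp.2 hsum).trans_eq ?_
    have h4 : 4 * Real.log L = Real.log (y ^ 16) := by
      rw [show y ^ 16 = L ^ 4 by rw [hLy]; ring, Real.log_pow]
      norm_num
    rw [add_comm, Real.exp_add, h4, Real.exp_log (by positivity)]
  set J := ⌊L ^ 2⌋₊ with hJ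
  have hJ1 : y ^ 8 ≤ (J : ℝ) + 1 := by
    refine le_trans (le_of_eq ?_) (Nat.lt_floor_add_one (L ^ 2)).le
    rw [hLy]; ring
  have hJ2 : (J : ℝ) + 1 ≤ 2 * y ^ 8 := by
    have h1 := Nat.floor_le (sq_nonneg L)
    have h2 : L ^ 2 = y ^ 8 := by rw [hLy]; ring
    have h3 : 1 ≤ L ^ 2 := one_le_pow₀ hL
    linarith
  rw [hLy] at hall
  rw [div_le_iff₀ hN]
  refine hmain.trans ?_
  have hq : |t| / √L * y = |t| / y := by
    rw [hs]
    field_simp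
  rw [hq]
  have hA : (⌊x⌋₊ : ℝ) * (∑ p ∈ primesIoc 0 ⌊x⌋₊, (1 : ℝ) / p) / (J + 1) ≤
      ⌊x⌋₊ * ((y ^ 4 + C) / y ^ 8) := by
    rw [mul_div_assoc]
    gcongr
  have hB : ((J : ℝ) + 1) * ((2 : ℝ) ^ (-y) *
      (⌊x⌋₊ * Real.exp (∑ p ∈ primesIoc 0 ⌊x⌋₊ \ midPrimes x, (1 : ℝ) / p))) ≤
      2 * y ^ 8 * ((2 : ℝ) ^ (-y) * (⌊x⌋₊ * (Real.exp (2 * C) * y ^ 16))) := by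
    gcongr
  calc _ ≤ ⌊x⌋₊ * (|t| / y) + 2 * (⌊x⌋₊ * ((y ^ 4 + C) / y ^ 8) +
        2 * y ^ 8 * ((2 : ℝ) ^ (-y) * (⌊x⌋₊ * (Real.exp (2 * C) * y ^ 16)))) := by
        linarith
    _ = _ := by ring

lemma tendsto_average_exp (t : ℝ) : Tendsto (fun x : ℝ =>
    (⌊x⌋₊ : ℂ)⁻¹ * ∑ n ∈ Finset.Ioc 0 ⌊x⌋₊, Complex.exp (((t * ((((n - n.primeFactors.card
      ).primeFactors.card : ℝ) - Real.log (Real.log x)) / √(Real.log (Real.log x))) : ℝ) : ℂ) *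
        Complex.I)) atTop (nhds (Complex.exp (-(t : ℂ) ^ 2 / 2))) := by
  have h1 := tendsto_average_exp_sub_twist t
  have h2 := tendsto_average_twist_sub t
  have h3 := tendsto_twistMean_midPrimes t
  refine h3.congr_dist (squeeze_zero' (Eventually.of_forall fun x => dist_nonneg) ?_
    (by simpa only [add_zero] using h1.add h2))
  filter_upwards [tendsto_log_log_atTop.eventually_gt_atTop 0, eventually_ge_atTop 1] with x hL hx
  have hN : (0 : ℝ) < ⌊x⌋₊ := by exact_mod_cast Nat.floor_pos.2 hx
  have hN' : (⌊x⌋₊ : ℂ) ≠ 0 := by exact_mod_cast hN.ne'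
  set L := Real.log (Real.log x) with hLdef
  have hs : 0 < √L := Real.sqrt_pos.2 hL
  have hLs : L / √L = √L := Real.div_sqrt
  have hterm : ∀ n : ℕ, Complex.exp (((t * ((((n - n.primeFactors.card
      ).primeFactors.card : ℝ) - L) / √L) : ℝ) : ℂ) * Complex.I) =
      Complex.exp (-(Complex.I * ((t * √L : ℝ) : ℂ))) *
        Complex.exp (Complex.I *
          ((t / √L * (n - n.primeFactors.card).primeFactors.card : ℝ) : ℂ)) := by
    intro n
    rw [← Complex.exp_add]
    congr 1
    rw [sub_div, hLs]
    push_cast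
    ring
  set e := Complex.exp (-(Complex.I * ((t * √L : ℝ) : ℂ))) with he
  have hne : ‖e‖ = 1 := by
    rw [he, show -(Complex.I * ((t * √L : ℝ) : ℂ)) = ((-(t * √L) : ℝ) : ℂ) * Complex.I by
      push_cast; ring, Complex.norm_exp_ofReal_mul_I]
  have hsplit : (⌊x⌋₊ : ℂ)⁻¹ * ∑ n ∈ Finset.Ioc 0 ⌊x⌋₊, e *
        Complex.exp (Complex.I * ((t / √L * (n - n.primeFactors.card).primeFactors.card : ℝ) : ℂ)) -
      e * twistMean (midPrimes x) (phase t x) = e * ((⌊x⌋₊ : ℂ)⁻¹ *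
      (∑ n ∈ Finset.Ioc 0 ⌊x⌋₊, (Complex.exp (Complex.I * ((t / √L *
      (n - n.primeFactors.card).primeFactors.card : ℝ) : ℂ)) -
      twist (midPrimes x) (phase t x) (n - n.primeFactors.card)) +
      ∑ n ∈ Finset.Ioc 0 ⌊x⌋₊, (twist (midPrimes x) (phase t x) (n - n.primeFactors.card) -
        twistMean (midPrimes x) (phase t x)))) := by
    rw [← Finset.sum_add_distrib]
    simp only [sub_add_sub_cancel]
    rw [Finset.sum_sub_distrib, Finset.sum_const, Nat.card_Ioc, nsmul_eq_mul, Nat.sub_zero,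
      ← Finset.mul_sum]
    field_simp
  simp only [hterm]
  rw [dist_comm, dist_eq_norm, hsplit, norm_mul, hne, one_mul, norm_mul, norm_inv,
    Complex.norm_natCast, ← add_div, inv_mul_eq_div]
  gcongr
  exact norm_add_le _ _

lemma gaussianReal_real_Iic (u : ℝ) : (ProbabilityTheory.gaussianReal 0 1).real (Set.Iic u) =
    (√(2 * Real.pi))⁻¹ * ∫ t in Set.Iic u, Real.exp (-t ^ 2 / 2) := by
  rw [MeasureTheory.measureReal_def,
    ProbabilityTheory.gaussianReal_apply_eq_integral _ one_ne_zero,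
    ENNReal.toReal_ofReal (MeasureTheory.integral_nonneg fun _ =>
      ProbabilityTheory.gaussianPDFReal_nonneg _ _ _), ← MeasureTheory.integral_const_mul]
  simp [ProbabilityTheory.gaussianPDFReal_def]

/-- A form of **Lévy's continuity theorem**: if the characteristic functions of the uniform
distributions on the values of `Y k` over `S k` converge to that of the standard Gaussian, then so
do their distribution functions. -/
lemma tendsto_card_filter_le_of_tendsto_average_exp {S : ℕ → Finset ℕ} (hS : ∀ k, (S k).Nonempty)
    (Y : ℕ → ℕ → ℝ) (h : ∀ t : ℝ, Tendsto (fun k => ((S k).card : ℂ)⁻¹ *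
      ∑ n ∈ S k, Complex.exp (((t * Y k n : ℝ) : ℂ) * Complex.I)) atTop
      (nhds (Complex.exp (-(t : ℂ) ^ 2 / 2)))) (u : ℝ) :
    Tendsto (fun k => (((S k).filter (fun n => Y k n ≤ u)).card : ℝ) / (S k).card) atTop
      (nhds ((√(2 * Real.pi))⁻¹ * ∫ t in Set.Iic u, Real.exp (-t ^ 2 / 2))) := by
  have hcard : ∀ k, ((S k).card : ENNReal) ≠ 0 := fun k => by
    exact_mod_cast (Finset.card_pos.2 (hS k)).ne'
  let ν : ℕ → MeasureTheory.Measure ℝ := fun k =>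
    ((S k).card : ENNReal)⁻¹ • ∑ n ∈ S k, MeasureTheory.Measure.dirac (Y k n)
  have hν : ∀ k, MeasureTheory.IsProbabilityMeasure (ν k) := fun k => ⟨by
    simp [ν, ENNReal.inv_mul_cancel (hcard k)]⟩
  let μ : ℕ → MeasureTheory.ProbabilityMeasure ℝ := fun k => ⟨ν k, hν k⟩
  let γ : MeasureTheory.ProbabilityMeasure ℝ := ⟨ProbabilityTheory.gaussianReal 0 1, inferInstance⟩
  have hchar : ∀ k (t : ℝ), MeasureTheory.charFun (ν k) t = ((S k).card : ℂ)⁻¹ *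
      ∑ n ∈ S k, Complex.exp (((t * Y k n : ℝ) : ℂ) * Complex.I) := by
    intro k t
    rw [MeasureTheory.charFun_apply_real, MeasureTheory.integral_smul_measure,
      MeasureTheory.integral_finsetSum_measure]
    · simp
    · intro n _
      exact MeasureTheory.integrable_dirac (by simp)
  have hconv : Tendsto μ atTop (nhds γ) := by
    refine MeasureTheory.ProbabilityMeasure.tendsto_iff_tendsto_charFun.2 fun t => ?_
    change Tendsto (fun k => MeasureTheory.charFun (ν k) t) atTop
      (nhds (MeasureTheory.charFun (ProbabilityTheory.gaussianReal 0 1) t))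
    simp only [hchar, ProbabilityTheory.charFun_gaussianReal]
    convert h t using 3
    simp [neg_div]
  have hnull : (γ : MeasureTheory.Measure ℝ) (frontier (Set.Iic u)) = 0 := by
    have := ProbabilityTheory.nullSingletonClass_gaussianReal (μ := 0) (v := 1) one_ne_zero
    rw [frontier_Iic]
    exact MeasureTheory.measure_singleton (μ := ProbabilityTheory.gaussianReal 0 1) u
  have hlim := MeasureTheory.ProbabilityMeasure.tendsto_measure_of_null_frontier_of_tendsto'
    hconv hnull
  have hlim' := (ENNReal.tendsto_toReal (MeasureTheory.measure_ne_top _ _)).comp hlim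
  rw [← gaussianReal_real_Iic]
  refine hlim'.congr fun k => ?_
  change (ν k (Set.Iic u)).toReal = _
  simp [ν, Set.indicator_apply, inv_mul_eq_div]

/-- Erdős–Kac law for ω(n − ω(n)). -/
theorem erdosKac_sub_omega (u : ℝ) :
    Tendsto (fun x : ℝ =>
      (((Finset.Icc 2 ⌊x⌋₊).filter (fun n : ℕ =>
        ((((n - n.primeFactors.card).primeFactors.card : ℝ) : ℝ)) - Real.log (Real.log x)
          ≤ u * Real.sqrt (Real.log (Real.log x)))).card : ℝ) / x)
      atTop
      (nhds ((Real.sqrt (2 * Real.pi))⁻¹ * ∫ t in Set.Iic u, Real.exp (-t ^ 2 / 2))) := by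
  set Y : ℝ → ℕ → ℝ := fun x n => (((n - n.primeFactors.card).primeFactors.card : ℝ) -
    Real.log (Real.log x)) / √(Real.log (Real.log x)) with hY
  have hIoc : Tendsto (fun x : ℝ =>
      (((Finset.Ioc 0 ⌊x⌋₊).filter (fun n => Y x n ≤ u)).card : ℝ) / ⌊x⌋₊) atTop
      (nhds ((√(2 * Real.pi))⁻¹ * ∫ t in Set.Iic u, Real.exp (-t ^ 2 / 2))) := by
    refine tendsto_of_seq_tendsto fun x hx => ?_
    have hz : Tendsto (fun k => max (x k) 1) atTop atTop :=
      tendsto_atTop_mono (fun k => le_max_left _ _) hx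
    have := tendsto_card_filter_le_of_tendsto_average_exp
      (S := fun k => Finset.Ioc 0 ⌊max (x k) 1⌋₊)
      (fun k => Finset.nonempty_Ioc.2 (Nat.floor_pos.2 (le_max_right _ _)))
      (fun k => Y (max (x k) 1))
      (fun t => by simpa only [Nat.card_Ioc, Nat.sub_zero] using! (tendsto_average_exp t).comp hz) u
    refine this.congr' ?_
    filter_upwards [hx.eventually_ge_atTop 1] with k hk
    simp only [max_eq_left hk, Nat.card_Ioc, Nat.sub_zero, Function.comp]
  have hfloor : Tendsto (fun x : ℝ => (⌊x⌋₊ : ℝ) / x) atTop (nhds 1) :=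
    tendsto_nat_floor_div_atTop
  have hmul := hIoc.mul hfloor
  rw [mul_one] at hmul
  refine hmul.congr_dist (squeeze_zero' (Eventually.of_forall fun x => dist_nonneg) ?_
    tendsto_inv_atTop_zero)
  filter_upwards [tendsto_log_log_atTop.eventually_gt_atTop 0, eventually_ge_atTop 1] with x hL hx
  have hN : (⌊x⌋₊ : ℝ) ≠ 0 := by exact_mod_cast (Nat.floor_pos.2 hx).ne'
  have hiff : ∀ n : ℕ, ((n - n.primeFactors.card).primeFactors.card : ℝ) - Real.log (Real.log x)
      ≤ u * √(Real.log (Real.log x)) ↔ Y x n ≤ u := fun n =>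
    (div_le_iff₀ (Real.sqrt_pos.2 hL)).symm
  simp only [hiff]
  have hsub : (Finset.Icc 2 ⌊x⌋₊).filter (fun n => Y x n ≤ u) ⊆
      (Finset.Ioc 0 ⌊x⌋₊).filter (fun n => Y x n ≤ u) :=
    Finset.filter_subset_filter _ fun n hn => by
      rw [Finset.mem_Icc] at hn
      exact Finset.mem_Ioc.2 ⟨by omega, hn.2⟩
  have hsup : (Finset.Ioc 0 ⌊x⌋₊).filter (fun n => Y x n ≤ u) ⊆
      insert 1 ((Finset.Icc 2 ⌊x⌋₊).filter (fun n => Y x n ≤ u)) := fun n hn => by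
    rw [Finset.mem_filter, Finset.mem_Ioc] at hn
    rw [Finset.mem_insert, Finset.mem_filter, Finset.mem_Icc]
    by_cases h1 : n = 1
    · exact Or.inl h1
    · exact Or.inr ⟨⟨by omega, hn.1.2⟩, hn.2⟩
  have h1 : (((Finset.Icc 2 ⌊x⌋₊).filter (fun n => Y x n ≤ u)).card : ℝ) ≤
      ((Finset.Ioc 0 ⌊x⌋₊).filter (fun n => Y x n ≤ u)).card := by
    exact_mod_cast Finset.card_le_card hsub
  have h2 : (((Finset.Ioc 0 ⌊x⌋₊).filter (fun n => Y x n ≤ u)).card : ℝ) ≤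
      ((Finset.Icc 2 ⌊x⌋₊).filter (fun n => Y x n ≤ u)).card + 1 := by
    exact_mod_cast (Finset.card_le_card hsup).trans (Finset.card_insert_le _ _)
  have hx0 : 0 < x := by linarith
  rw [div_mul_div_cancel₀ hN, Real.dist_eq, ← sub_div, abs_of_nonneg (by
    apply div_nonneg _ hx0.le; linarith), ← one_div]
  gcongr
  linarith
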